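/- (Aljadeff–Ginosar, group ring case) Let k be a ring, G a group, M a kG-module (not necessarily finitely generated), and H a normal subgroup of G of finite index. Assume that M is projective as a kE-module for every subgroup E with H ≤ E ≤ G such that E/H is elementary abelian. Then M is projective as a kG-module. -/

import Mathlib

open CategoryTheory

noncomputable section

/-- `f : ℕ → ℝ≥0` is a proper complexity function. -/
def IsProperComplexityFunction (f : ℕ → NNReal) : Prop :=
  ∀ n : ℤ, ∃ c : NNReal, ∀ m : ℕ, 0 ≤ (m : ℤ) + n → f ((m : ℤ) + n).toNat < c * f m

/-- The module `P` can be generated by at most `b` elements over `R`. -/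
def RankLE (R : Type) [Ring R] (P : Type) [AddCommGroup P] [Module R P] (b : NNReal) : Prop :=
  ∃ s : Finset P, Submodule.span R (s : Set P) = ⊤ ∧ (s.card : NNReal) ≤ b

/-- `c_R(M) ≤ f` : `M` has a projective resolution whose `n`-th term has rank at most
`d * f n` for some constant `d`. -/
def ComplexityLE (R : Type) [Ring R] (M : ModuleCat.{0} R) (f : ℕ → NNReal) : Prop :=
  ∃ (P : ProjectiveResolution M) (d : NNReal),
    ∀ n : ℕ, RankLE R (P.complex.X n) (d * f n)

/-- `cds_R(M) ≤ f` : complexity at most `f` up to a direct summand. -/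
def CdsLE (R : Type) [Ring R] (M : ModuleCat.{0} R) (f : ℕ → NNReal) : Prop :=
  ∃ N : ModuleCat.{0} R, ComplexityLE R (ModuleCat.of R (M × N)) f

/-- The ring homomorphism `k[H] →+* k[G]` induced by the inclusion of a subgroup `H ≤ G`. -/
def subgroupRingHom (k : Type) [Ring k] {G : Type} [Group G] (H : Subgroup G) :
    MonoidAlgebra k H →+* MonoidAlgebra k G :=
  MonoidAlgebra.mapDomainRingHom k H.subtype

/-- Restriction of a `k[G]`-module to a `k[H]`-module, `H ≤ G`. -/
def resMod (k : Type) [Ring k] {G : Type} [Group G] (H : Subgroup G)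
    (M : ModuleCat.{0} (MonoidAlgebra k G)) : ModuleCat.{0} (MonoidAlgebra k H) :=
  (ModuleCat.restrictScalars (subgroupRingHom k H)).obj M

/-- A group is elementary abelian if it is isomorphic to `(ℤ/p)^r` for a prime `p`. -/
def IsElementaryAbelian (Q : Type) [Group Q] : Prop :=
  ∃ (p r : ℕ), p.Prime ∧ Nonempty (Q ≃* Multiplicative (Fin r → ZMod p))

/-- A group is `p`-elementary abelian if it is isomorphic to `(ℤ/p)^r`. -/
def IsPElementaryAbelian (p : ℕ) (Q : Type) [Group Q] : Prop :=
  ∃ r : ℕ,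
  Nonempty (Q ≃* Multiplicative (Fin r → ZMod p))
namespace RelTrace

open Representation Finset
open scoped Pointwise

section Basic

variable {R P X Y : Type*} [CommRing R] [Group P]
  [AddCommGroup X] [Module R X] [AddCommGroup Y] [Module R Y]

lemma rho_inv_rho (ρ : Representation R P X) (g : P) (x : X) : ρ g⁻¹ (ρ g x) = x := by
  simp

lemma rho_rho_inv (ρ : Representation R P X) (g : P) (x : X) : ρ g (ρ g⁻¹ x) = x := by
  simp

lemma map_mem_ker (ρ : Representation R P X) (σ : Representation R P Y) (t : X →ₗ[R] Y)
    (ht : ∀ g x, t (ρ g x) = σ g (t x)) {x : X}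
    (hx : x ∈ Coinvariants.ker ρ) : t x ∈ Coinvariants.ker σ := by
  induction hx using Submodule.span_induction with
  | mem x h => obtain ⟨⟨g, y⟩, rfl⟩ := h; simpa [ht] using Coinvariants.sub_mem_ker g (t y)
  | zero => simp
  | add x y _ _ hx hy => simpa using add_mem hx hy
  | smul a x _ hx => simpa using Submodule.smul_mem _ a hx

variable [Fintype P]

/-- The relative trace `∑ g s g⁻¹` of an endomorphism of a representation. -/
def conjTrace (ρ : Representation R P X) (s : X →ₗ[R] X) : X →ₗ[R] X :=
  ∑ g, ρ g ∘ₗ s ∘ₗ ρ g⁻¹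

lemma conjTrace_apply (ρ : Representation R P X) (s : X →ₗ[R] X) (x : X) :
    conjTrace ρ s x = ∑ g, ρ g (s (ρ g⁻¹ x)) := by
  simp [conjTrace]

lemma conjTrace_equivariant (ρ : Representation R P X) (s : X →ₗ[R] X) (g : P) (x : X) :
    conjTrace ρ s (ρ g x) = ρ g (conjTrace ρ s x) := by
  rw [conjTrace_apply, conjTrace_apply, map_sum]
  refine (Fintype.sum_equiv (Equiv.mulLeft g) _ _ fun h => ?_).symm
  simp only [Equiv.coe_mulLeft, mul_inv_rev, map_mul, Module.End.mul_apply, rho_inv_rho]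

lemma norm_apply (ρ : Representation R P X) (x : X) : norm ρ x = ∑ g, ρ g x := by
  simp [Representation.norm]

lemma rho_norm (ρ : Representation R P X) (g : P) (x : X) : ρ g (norm ρ x) = norm ρ x := by
  simp

lemma norm_of_conjTrace_of_invariant (ρ : Representation R P X) (s : X →ₗ[R] X) {x : X}
    (hx : ∀ g, ρ g x = x) : norm ρ (s x) = conjTrace ρ s x := by
  simp [norm_apply, conjTrace_apply, hx]

lemma norm_conjTrace (ρ : Representation R P X) (s : X →ₗ[R] X) (x : X) :
    norm ρ (conjTrace ρ s x) = conjTrace ρ s (norm ρ x) := by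
  simp only [norm_apply, map_sum, conjTrace_equivariant]

lemma norm_eq_zero_of_mem_ker (ρ : Representation R P X) {x : X}
    (hx : x ∈ Coinvariants.ker ρ) : norm ρ x = 0 := by
  induction hx using Submodule.span_induction with
  | mem x h => obtain ⟨⟨g, y⟩, rfl⟩ := h; simp
  | zero => simp
  | add x y _ _ hx hy => simp [hx, hy]
  | smul a x _ hx => simp [hx]

/-- A sum `∑ g t(g⁻¹ x)` lies in the augmentation submodule as soon as `∑ t(g⁻¹ x)` vanishes. -/
lemma sum_mem_ker (ρ : Representation R P X) (σ : Representation R P Y) (t : X →ₗ[R] Y) {x : X}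
    (hx : norm ρ x = 0) : ∑ g, σ g (t (ρ g⁻¹ x)) ∈ Coinvariants.ker σ := by
  have h0 : ∑ g, t (ρ g⁻¹ x) = 0 := by
    rw [← map_sum, Fintype.sum_equiv (Equiv.inv P) (fun g => ρ g⁻¹ x) (fun g => ρ g x)
      (fun g => rfl), ← norm_apply, hx, map_zero]
  have : ∑ g, σ g (t (ρ g⁻¹ x)) = ∑ g, (σ g (t (ρ g⁻¹ x)) - t (ρ g⁻¹ x)) := by
    rw [sum_sub_distrib, h0, sub_zero]
  rw [this]
  exact Submodule.sum_mem _ fun g _ => Coinvariants.sub_mem_ker g _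

/-- `X` is weakly projective relative to the trivial group after restriction to `S`. -/
def WeaklyProjectiveOn (ρ : Representation R P X) (S : Subgroup P) : Prop :=
  ∃ s : X →ₗ[R] X, ∀ x, ∑ᶠ g : S, ρ g (s (ρ (g : P)⁻¹ x)) = x

/-- `X` is weakly projective on every proper subgroup. -/
def ProperlyProjective (ρ : Representation R P X) : Prop :=
  ∀ S : Subgroup P, S ≠ ⊤ → WeaklyProjectiveOn ρ S

/-- Orbitwise choice of splittings for an action all of whose point stabilisers are proper. -/
lemma ProperlyProjective.exists_family {ρ : Representation R P X} (hX : ProperlyProjective ρ)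
    (T : Type*) [MulAction P T] :
    ∃ t : T → X →ₗ[R] X, ∀ a : T, MulAction.stabilizer P a ≠ ⊤ →
      ∀ x, ∑ g, ρ g (t (g⁻¹ • a) (ρ g⁻¹ x)) = x := by
  classical
  have hs : ∀ S : Subgroup P, ∃ s : X →ₗ[R] X, S ≠ ⊤ →
      ∀ x, ∑ᶠ g : S, ρ g (s (ρ (g : P)⁻¹ x)) = x := fun S => by
    by_cases h : S = ⊤
    · exact ⟨0, fun h' => (h' h).elim⟩
    · obtain ⟨s, hs⟩ := hX S h
      exact ⟨s, fun _ => hs⟩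
  choose s hs using hs
  let rep : T → T := fun a => (Quotient.mk (MulAction.orbitRel P T) a).out
  have hrep : ∀ (g : P) a, rep (g • a) = rep a := fun g a => by
    have : Quotient.mk (MulAction.orbitRel P T) (g • a) = Quotient.mk _ a :=
      Quotient.sound ⟨g, rfl⟩
    simp only [rep, this]
  refine ⟨fun a => if a = rep a then s (MulAction.stabilizer P a) else 0, fun a ha x => ?_⟩
  obtain ⟨g₀, hg₀⟩ : ∃ g : P, g • rep a = a := by
    have : (MulAction.orbitRel P T) (rep a) a := Quotient.exact (Quotient.out_eq _)
    exact (MulAction.orbitRel P T).symm this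
  set b := rep a with hb
  have hbS : MulAction.stabilizer P b ≠ ⊤ := fun h => by
    have : g₀ • b = b := MulAction.mem_stabilizer_iff.1 (h ▸ Subgroup.mem_top g₀)
    exact ha (by rw [← hg₀, this, h])
  have key : ∀ g : P, ρ g ((if g⁻¹ • a = rep (g⁻¹ • a) then
      s (MulAction.stabilizer P (g⁻¹ • a)) else 0) (ρ g⁻¹ x)) =
      if g₀⁻¹ * g ∈ MulAction.stabilizer P b then
        ρ g (s (MulAction.stabilizer P b) (ρ g⁻¹ x)) else 0 := fun g => by
    have hiff : g⁻¹ • a = b ↔ g₀⁻¹ * g ∈ MulAction.stabilizer P b := by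
      rw [MulAction.mem_stabilizer_iff, mul_smul, inv_smul_eq_iff, inv_smul_eq_iff, hg₀]
      exact eq_comm
    rw [hrep, ← hb]
    by_cases h : g⁻¹ • a = b
    · rw [if_pos h, if_pos (hiff.1 h), h]
    · rw [if_neg h, if_neg (fun h' => h (hiff.2 h'))]; simp
  rw [sum_congr rfl fun g _ => key g,
    ← Fintype.sum_equiv (Equiv.mulLeft g₀) (fun h => if h ∈ MulAction.stabilizer P b then
        ρ (g₀ * h) (s (MulAction.stabilizer P b) (ρ (g₀ * h)⁻¹ x)) else 0) _
        (fun h => by simp)]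
  rw [← sum_filter, ← rho_rho_inv ρ g₀ x]
  conv_rhs => rw [← hs _ hbS (ρ g₀⁻¹ x), finsum_eq_sum_of_fintype, map_sum]
  rw [rho_rho_inv]
  rw [sum_subtype (p := fun h => h ∈ MulAction.stabilizer P b) _ (by simp)]
  refine Fintype.sum_congr _ _ fun h => ?_
  simp

end Basic

section Relation

variable {R P X V₀ V₁ : Type*} [CommRing R] [Group P] [Fintype P]
  [AddCommGroup X] [Module R X] [AddCommGroup V₀] [Module R V₀] [AddCommGroup V₁] [Module R V₁]

/-- A two-term coresolution `X → V₀ → V₁ → V₁ / K₁` which is exact up to relative traces. -/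
structure TwoStep (ρ : Representation R P X) (V₀ V₁ : Type*) [AddCommGroup V₀] [Module R V₀]
    [AddCommGroup V₁] [Module R V₁] where
  /-- the action on `V₀` -/
  ρ₀ : Representation R P V₀
  /-- the action on `V₁` -/
  ρ₁ : Representation R P V₁
  /-- the first map -/
  ι : X →ₗ[R] V₀
  /-- the second map -/
  d : V₀ →ₗ[R] V₁
  /-- the approximate image of the second map -/
  K₁ : Submodule R V₁
  /-- approximate splitting -/
  τ₀ : V₀ →ₗ[R] V₀
  /-- approximate splitting -/
  τ₁ : V₁ →ₗ[R] V₁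
  ι_equivariant : ∀ g x, ι (ρ g x) = ρ₀ g (ι x)
  d_equivariant : ∀ g x, d (ρ₀ g x) = ρ₁ g (d x)
  K₁_stable : ∀ g, ∀ x ∈ K₁, ρ₁ g x ∈ K₁
  ι_injective : Function.Injective ι
  d_ι : ∀ x, d (ι x) = 0
  τ₀_ker : ∀ x, d x = 0 → d (τ₀ x) = 0
  τ₀_range : ∀ x, ∃ y, τ₀ (ι x) = ι y
  τ₀_spec : ∀ x, d x = 0 → ∃ y, x - conjTrace ρ₀ τ₀ x = ι y
  τ₁_K₁ : ∀ x ∈ K₁, τ₁ x ∈ K₁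
  τ₁_range : ∀ x, ∃ y, τ₁ (d x) = d y
  τ₁_spec : ∀ x ∈ K₁, ∃ y, x - conjTrace ρ₁ τ₁ x = d y

namespace TwoStep

variable {ρ : Representation R P X} (C : TwoStep ρ V₀ V₁)

/-- The connecting relation between elements of `V₁` whose norm lies in `K₁` and 1-cocycles. -/
def Connects (b : V₁) (z : P → X) : Prop :=
  ∃ k ∈ C.K₁, ∃ b₀ : V₀, norm C.ρ₁ (b + k) = C.d b₀ ∧ ∀ g, C.ρ₀ g b₀ - b₀ = C.ι (z g)

variable {C}

lemma Connects.sub {b b' : V₁} {z z' : P → X} (h : C.Connects b z) (h' : C.Connects b' z') :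
    C.Connects (b - b') (z - z') := by
  obtain ⟨k, hk, c, hc, hz⟩ := h
  obtain ⟨k', hk', c', hc', hz'⟩ := h'
  refine ⟨k - k', sub_mem hk hk', c - c', ?_, fun g => ?_⟩
  · rw [map_sub, ← hc, ← hc', ← map_sub]; congr 1; abel
  · rw [Pi.sub_apply, map_sub, map_sub, ← hz, ← hz']; abel

lemma Connects.congr {b b' : V₁} {z : P → X} (h : C.Connects b z) (hb : b - b' ∈ C.K₁) :
    C.Connects b' z := by
  obtain ⟨k, hk, c, hc, hz⟩ := h
  refine ⟨(b - b') + k, add_mem hb hk, c, ?_, hz⟩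
  rw [← hc]; congr 1; abel

variable (C) in
lemma exists_connects {b : V₁} (hb : norm C.ρ₁ b ∈ C.K₁) : ∃ z, C.Connects b z := by
  obtain ⟨b₀, hb₀⟩ := C.τ₁_spec _ hb
  have hn : norm C.ρ₁ (b + -C.τ₁ (norm C.ρ₁ b)) = C.d b₀ := by
    rw [← hb₀, map_add, map_neg, norm_of_conjTrace_of_invariant _ _ (rho_norm _ · _),
      sub_eq_add_neg]
  let c : P → V₀ := fun g => C.ρ₀ g b₀ - b₀
  have hc : ∀ g, C.d (c g) = 0 := fun g => by
    simp only [c]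
    rw [map_sub, C.d_equivariant, ← hn, rho_norm, sub_self]
  choose z hz using fun g => C.τ₀_spec (c g) (hc g)
  let w : V₀ := ∑ h, C.ρ₀ h (C.τ₀ (C.ρ₀ h⁻¹ (c h)))
  have hw : ∀ g, C.ρ₀ g w = w - conjTrace C.ρ₀ C.τ₀ (c g) := fun g => by
    have : C.ρ₀ g w = ∑ h, C.ρ₀ h (C.τ₀ (C.ρ₀ h⁻¹ (C.ρ₀ g (c (g⁻¹ * h))))) := by
      simp only [w, map_sum]
      refine Fintype.sum_equiv (Equiv.mulLeft g) _ _ fun h => ?_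
      simp
    rw [this, conjTrace_apply, ← sum_sub_distrib]
    refine sum_congr rfl fun h _ => ?_
    rw [← map_sub, ← map_sub, ← map_sub]
    congr 3
    simp only [c, map_mul, Module.End.mul_apply, map_sub, rho_rho_inv]
    abel
  refine ⟨z, _, neg_mem (C.τ₁_K₁ _ hb), b₀ + w, ?_, fun g => ?_⟩
  · rw [hn, map_add]
    have : C.d w = 0 := by
      simp only [w, map_sum, C.d_equivariant]
      refine sum_eq_zero fun h _ => ?_
      rw [C.τ₀_ker, map_zero]
      rw [C.d_equivariant, hc, map_zero]
    rw [this, add_zero]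
  · rw [map_add, hw, ← hz]
    simp only [c]
    abel

lemma Connects.principal {b k : V₁} {z : P → X} (h : C.Connects b z)
    (hb : b - k ∈ Coinvariants.ker C.ρ₁) (hk : k ∈ C.K₁) : ∃ x, ∀ g, z g = ρ g x - x := by
  obtain ⟨k', hk', b₀, hb₀, hz⟩ := h
  set w := k + k'
  have hw : w ∈ C.K₁ := add_mem hk hk'
  have hn : norm C.ρ₁ w = C.d b₀ := by
    rw [← hb₀, ← sub_eq_zero, ← map_sub, ← neg_eq_zero, ← map_neg]
    refine norm_eq_zero_of_mem_ker _ ?_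
    convert hb using 1
    simp only [w]; abel
  obtain ⟨y₁, hy₁⟩ := C.τ₁_spec w hw
  obtain ⟨y₂, hy₂⟩ := C.τ₁_range b₀
  have hc : norm C.ρ₁ (C.d (y₁ + y₂)) = norm C.ρ₁ w := by
    rw [map_add, ← hy₁, ← hy₂, ← hn, map_add, map_sub, norm_conjTrace,
      norm_of_conjTrace_of_invariant _ _ (rho_norm _ · _), sub_add_cancel]
  set w₀ := b₀ - norm C.ρ₀ (y₁ + y₂) with hw₀
  have hdw : C.d w₀ = 0 := by
    rw [hw₀, map_sub, ← hn, ← hc, norm_apply, norm_apply, map_sum]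
    simp only [C.d_equivariant, sub_self]
  have hgw : ∀ g, C.ρ₀ g w₀ = w₀ + C.ι (z g) := fun g => by
    rw [← hz, hw₀, map_sub, rho_norm]; abel
  obtain ⟨x', hx'⟩ := C.τ₀_spec w₀ hdw
  choose f hf using fun h => C.τ₀_range (z h⁻¹)
  have hx'' : conjTrace C.ρ₀ C.τ₀ w₀ = norm C.ρ₀ (C.τ₀ w₀) + C.ι (∑ h, ρ h (f h)) := by
    simp only [conjTrace_apply, hgw, map_add, hf, sum_add_distrib, norm_apply, map_sum,
      C.ι_equivariant]
  refine ⟨x' + ∑ h, ρ h (f h), fun g => C.ι_injective ?_⟩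
  rw [map_sub, C.ι_equivariant, map_add, ← sub_eq_iff_eq_add'.2 hx'', ← hx',
    ← sub_eq_iff_eq_add'.2 (hgw g)]
  simp only [map_sub, map_add, rho_norm]
  abel

variable {W₀ W₁ : Type*} [AddCommGroup W₀] [Module R W₀] [AddCommGroup W₁] [Module R W₁]

lemma Connects.map {D : TwoStep ρ W₀ W₁} {b : V₁} {z : P → X} (h : C.Connects b z)
    (f₀ : V₀ →ₗ[R] W₀) (f₁ : V₁ →ₗ[R] W₁)
    (h₀ : ∀ g x, f₀ (C.ρ₀ g x) = D.ρ₀ g (f₀ x)) (h₁ : ∀ g x, f₁ (C.ρ₁ g x) = D.ρ₁ g (f₁ x))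
    (hd : ∀ x, f₁ (C.d x) = D.d (f₀ x)) (hι : ∀ x, f₀ (C.ι x) = D.ι x)
    (hK : ∀ x ∈ C.K₁, f₁ x ∈ D.K₁) : D.Connects (f₁ b) z := by
  obtain ⟨k, hk, b₀, hb₀, hz⟩ := h
  refine ⟨f₁ k, hK k hk, f₀ b₀, ?_, fun g => ?_⟩
  · rw [← map_add, ← hd, ← hb₀, norm_apply, norm_apply, map_sum]
    simp only [h₁]
  · rw [← h₀, ← map_sub, hz, hι]

/-- If `V₀` and `V₁` are weakly projective, then a principal cocycle is connected only with
elements of the augmentation submodule, modulo `K₁` and the image of `V₀`. -/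
lemma Connects.exists_of_principal {b : V₁} {z : P → X} (h : C.Connects b z)
    (x : X) (hx : ∀ g, z g = ρ g x - x)
    (s₀ : V₀ →ₗ[R] V₀) (hs₀ : ∀ y, conjTrace C.ρ₀ s₀ y = y)
    (s₁ : V₁ →ₗ[R] V₁) (hs₁ : ∀ y, conjTrace C.ρ₁ s₁ y = y) :
    ∃ k ∈ C.K₁, ∃ y, b + k - C.d y ∈ Coinvariants.ker C.ρ₁ := by
  obtain ⟨k, hk, b₀, hb₀, hz⟩ := h
  refine ⟨k, hk, s₀ (b₀ - C.ι x), ?_⟩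
  have hinv : ∀ g, C.ρ₀ g (b₀ - C.ι x) = b₀ - C.ι x := fun g => by
    rw [map_sub, ← C.ι_equivariant, ← sub_eq_zero, ← sub_eq_zero.2 (hz g), hx, map_sub]; abel
  have hn : norm C.ρ₁ (b + k - C.d (s₀ (b₀ - C.ι x))) = 0 := by
    have : norm C.ρ₁ (C.d (s₀ (b₀ - C.ι x))) = C.d (norm C.ρ₀ (s₀ (b₀ - C.ι x))) := by
      simp only [norm_apply, map_sum, C.d_equivariant]
    rw [map_sub, hb₀, this, norm_of_conjTrace_of_invariant _ _ hinv, hs₀, map_sub, C.d_ι,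
      sub_zero, sub_self]
  have := sum_mem_ker C.ρ₁ C.ρ₁ s₁ hn
  rwa [← conjTrace_apply, hs₁] at this

end TwoStep

end Relation

section Slots

variable {R P I X B C : Type*} [CommRing R] [Group P]
  [AddCommGroup X] [Module R X] [AddCommGroup B] [Module R B] [AddCommGroup C] [Module R C]

/-- Pulling back multilinear maps along a permutation of the slots and slotwise linear maps. -/
def pull (r : Equiv.Perm I) (φ : I → B →ₗ[R] C) :
    MultilinearMap R (fun _ : I => C) X →ₗ[R] MultilinearMap R (fun _ : I => B) X where
  toFun f := (f.compLinearMap φ).domDomCongr r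
  map_add' _ _ := by ext; simp
  map_smul' _ _ := by ext; simp

@[simp]
lemma pull_apply (r : Equiv.Perm I) (φ : I → B →ₗ[R] C) (f : MultilinearMap R (fun _ : I => C) X)
    (y : I → B) : pull r φ f y = f (fun i => φ i (y (r i))) := rfl

/-- Postcomposition of multilinear maps with a linear map. -/
def post (s : X →ₗ[R] X) :
    MultilinearMap R (fun _ : I => B) X →ₗ[R] MultilinearMap R (fun _ : I => B) X where
  toFun f := s.compMultilinearMap f
  map_add' _ _ := by ext; simp
  map_smul' _ _ := by ext; simp

@[simp]
lemma post_apply (s : X →ₗ[R] X) (f : MultilinearMap R (fun _ : I => B) X) (y : I → B) :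
    post s f y = s (f y) := rfl

/-- The family of multilinear maps `y ↦ (∏ Θ i (y i)) • m`. -/
def prodSmul [Fintype I] (Θ : I → B →ₗ[R] R) : X →ₗ[R] MultilinearMap R (fun _ : I => B) X where
  toFun m := ((MultilinearMap.mkPiAlgebra R I R).compLinearMap Θ).smulRight m
  map_add' _ _ := by ext; simp
  map_smul' c m := by ext y; exact smul_comm _ c m

@[simp]
lemma prodSmul_apply [Fintype I] (Θ : I → B →ₗ[R] R) (m : X) (y : I → B) :
    prodSmul Θ m y = (∏ i, Θ i (y i)) • m := rfl

variable [MulAction P I]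

variable (R P I B) in
/-- A twisted action of `P` on `I → B`, permuting the slots through the action on `I`. -/
structure SlotAction where
  /-- the map from the slot `i` to the slot `g • i` -/
  ψ : P → I → B →ₗ[R] B
  one_apply : ∀ i b, ψ 1 i b = b
  mul_apply : ∀ g h i b, ψ (g * h) i b = ψ g (h • i) (ψ h i b)

/-- The representation on multilinear maps induced by a slot action. -/
def SlotAction.rep (a : SlotAction R P I B) (ρ : Representation R P X) :
    Representation R P (MultilinearMap R (fun _ : I => B) X) where
  toFun g := post (ρ g) ∘ₗ
    { toFun f := (f.domDomCongr (MulAction.toPerm g)).compLinearMap (fun j => a.ψ g⁻¹ j)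
      map_add' _ _ := by ext; simp
      map_smul' _ _ := by ext; simp }
  map_one' := by
    refine LinearMap.ext fun f => MultilinearMap.ext fun (y : I → B) => ?_
    change ρ 1 (f fun i => a.ψ 1⁻¹ ((1 : P) • i) (y ((1 : P) • i))) = f y
    simp only [one_smul, inv_one, a.one_apply, map_one, Module.End.one_apply]
  map_mul' g h := by
    refine LinearMap.ext fun f => MultilinearMap.ext fun (y : I → B) => ?_
    change ρ (g * h) (f fun i => a.ψ (g * h)⁻¹ ((g * h) • i) (y ((g * h) • i))) =
      ρ g (ρ h (f fun i => a.ψ h⁻¹ (h • i) (a.ψ g⁻¹ (g • h • i) (y (g • h • i)))))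
    simp only [mul_smul, mul_inv_rev, a.mul_apply, inv_smul_smul, map_mul, Module.End.mul_apply]

@[simp]
lemma SlotAction.rep_apply (a : SlotAction R P I B) (ρ : Representation R P X) (g : P)
    (f : MultilinearMap R (fun _ : I => B) X) (y : I → B) :
    a.rep ρ g f y = ρ g (f (fun i => a.ψ g⁻¹ (g • i) (y (g • i)))) := rfl

lemma pull_equivariant (a : SlotAction R P I B) (c : SlotAction R P I C)
    (ρ : Representation R P X) (r : Equiv.Perm I) (φ : I → B →ₗ[R] C)
    (hr : ∀ (g : P) i, r (g • i) = g • r i)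
    (h : ∀ g i b, c.ψ g i (φ i b) = φ (g • i) (a.ψ g (r i) b)) (g : P)
    (f : MultilinearMap R (fun _ : I => C) X) :
    pull r φ (c.rep ρ g f) = a.rep ρ g (pull r φ f) := by
  refine MultilinearMap.ext fun (y : I → B) => ?_
  simp only [pull_apply, SlotAction.rep_apply, h, hr, inv_smul_smul]

/-- Multilinear maps vanishing as soon as `s` entries lie in `A`. -/
def vanishing (X I : Type*) [AddCommGroup X] [Module R X] (A : Submodule R B) (s : ℕ) :
    Submodule R (MultilinearMap R (fun _ : I => B) X) where
  carrier := {f | ∀ (y : I → B) (T : Finset I), T.card = s → (∀ i ∈ T, y i ∈ A) → f y = 0}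
  add_mem' hf hg y T hT hy := by simp [hf y T hT hy, hg y T hT hy]
  zero_mem' y T hT hy := rfl
  smul_mem' c f hf y T hT hy := by simp [hf y T hT hy]

variable [DecidableEq I]

lemma rep_mem_vanishing (a : SlotAction R P I B) (ρ : Representation R P X) {A : Submodule R B}
    (hA : ∀ g i, ∀ b ∈ A, a.ψ g i b ∈ A) {s : ℕ} (g : P)
    {f : MultilinearMap R (fun _ : I => B) X} (hf : f ∈ vanishing X I A s) :
    a.rep ρ g f ∈ vanishing X I A s := by
  intro y T hT hy
  rw [SlotAction.rep_apply, hf _ (g⁻¹ • T) (by simpa using hT), map_zero]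
  intro i hi
  refine hA _ _ _ (hy _ ?_)
  rwa [mem_inv_smul_finset_iff] at hi

variable [Fintype P]

lemma conjTrace_mem_vanishing (a : SlotAction R P I B) (ρ : Representation R P X)
    {A : Submodule R B} (hA : ∀ g i, ∀ b ∈ A, a.ψ g i b ∈ A) {s : ℕ}
    {τ : MultilinearMap R (fun _ : I => B) X →ₗ[R] MultilinearMap R (fun _ : I => B) X}
    (hτ : ∀ f ∈ vanishing X I A s, τ f ∈ vanishing X I A s)
    {f : MultilinearMap R (fun _ : I => B) X} (hf : f ∈ vanishing X I A s) :
    conjTrace (a.rep ρ) τ f ∈ vanishing X I A s := by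
  rw [conjTrace_apply]
  exact Submodule.sum_mem _ fun g _ =>
    rep_mem_vanishing a ρ hA g (hτ _ (rep_mem_vanishing a ρ hA g⁻¹ hf))

variable [Fintype I]

/-- A multilinear map takes the same value on `y` and `y'` if it vanishes on every family
mixing their entries and containing a difference of their entries. -/
lemma multilinear_congr (f : MultilinearMap R (fun _ : I => B) X) (y y' : I → B)
    (h : ∀ (i : I) (z : I → B), y i ≠ y' i → z i = y i - y' i →
      (∀ j, j ≠ i → z j = y j ∨ z j = y' j) → f z = 0) : f y = f y' := by
  have key : ∀ T : Finset I, f (T.piecewise y' y) = f y := fun T => by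
    induction T using Finset.induction_on with
    | empty => simp
    | insert i T hi ih =>
      by_cases hy : y i = y' i
      · rw [← ih]
        congr 1
        ext j
        by_cases hj : j = i
        · subst hj; simp [hi, hy]
        · simp [Finset.piecewise, hj]
      rw [← ih, Finset.piecewise_insert]
      have := f.map_update_sub (T.piecewise y' y) i (y i) (y' i)
      rw [h i _ hy (by simp)] at this
      · have h2 : Function.update (T.piecewise y' y) i (y i) = T.piecewise y' y := by
          rw [Function.update_eq_self_iff]; simp [hi]
        rw [h2] at this
        exact (sub_eq_zero.1 this.symm).symm
      · intro j hj
        rw [Function.update_of_ne hj]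
        by_cases hT : j ∈ T <;> simp [hT]
  rw [← key univ]; simp

/-- One filtration step: modulo relative traces, `vanishing (s + 1)` is contained in
`vanishing s`. -/
lemma exists_filtration_step (a : SlotAction R P I B) {ρ : Representation R P X}
    (hX : ProperlyProjective ρ) [MulAction.IsPretransitive P I]
    {A : Submodule R B} (hA : ∀ g i, ∀ b ∈ A, a.ψ g i b ∈ A)
    (q : B →ₗ[R] B) (hq : ∀ b, q b ∈ A) (hqA : ∀ b ∈ A, q b = b)
    {s : ℕ} (hs : s ≠ 0) (hsI : s < Fintype.card I) :
    ∃ τ : MultilinearMap R (fun _ : I => B) X →ₗ[R] MultilinearMap R (fun _ : I => B) X,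
      (∀ r, ∀ f ∈ vanishing X I A r, τ f ∈ vanishing X I A r) ∧
      ∀ f ∈ vanishing X I A (s + 1), f - conjTrace (a.rep ρ) τ f ∈ vanishing X I A s := by
  obtain ⟨t, ht⟩ := hX.exists_family (Finset I)
  have hstab : ∀ T : Finset I, T.card = s → MulAction.stabilizer P T ≠ ⊤ := fun T hT htop => by
    obtain ⟨i, hi⟩ : T.Nonempty := by rw [← card_pos]; omega
    have : T = univ := by
      refine eq_univ_of_forall fun j => ?_
      obtain ⟨g, rfl⟩ := MulAction.exists_smul_eq P i j
      have hg : g • T = T := MulAction.mem_stabilizer_iff.1 (htop ▸ Subgroup.mem_top g)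
      rw [← hg]
      exact smul_mem_smul_finset hi
    rw [this, card_univ] at hT
    omega
  let cut : Finset I → I → B →ₗ[R] B := fun T i => if i ∈ T then LinearMap.id else
    LinearMap.id - q
  have hcut : ∀ T i, ∀ b ∈ A, cut T i b ∈ A := fun T i b hb => by
    by_cases hi : i ∈ T
    · simpa [cut, hi] using hb
    · simp [cut, hi, hqA b hb]
  let τ : MultilinearMap R (fun _ : I => B) X →ₗ[R] MultilinearMap R (fun _ : I => B) X :=
    ∑ T ∈ univ.filter (fun T : Finset I => T.card = s), pull 1 (cut T) ∘ₗ post (t T)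
  have hτ : ∀ f y, τ f y = ∑ T ∈ univ.filter (fun T : Finset I => T.card = s),
      t T (f fun i => cut T i (y i)) := fun f y => by
    simp [τ]
  refine ⟨τ, fun r f hf y T hT hy => ?_, fun f hf y T hT hy => ?_⟩
  · rw [hτ]
    refine sum_eq_zero fun T' _ => ?_
    rw [hf _ T hT fun i hi => hcut _ _ _ (hy i hi), map_zero]
  · rw [_root_.sub_apply, sub_eq_zero, conjTrace_apply, _root_.sum_apply]
    conv_lhs => rw [← ht T (hstab T hT) (f y)]
    refine sum_congr rfl fun g _ => ?_
    rw [SlotAction.rep_apply]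
    congr 1
    generalize hy' : (fun i => a.ψ g⁻¹ (g • i) (y (g • i))) = y'
    rw [hτ]
    have hyA : ∀ i ∈ g⁻¹ • T, y' i ∈ A := fun i hi => by
      subst hy'
      refine hA _ _ _ (hy _ ?_)
      rwa [mem_inv_smul_finset_iff] at hi
    have hTg : (g⁻¹ • T).card = s := by simpa using hT
    set f' := a.rep ρ g⁻¹ f with hf'
    have hf'v : f' ∈ vanishing X I A (s + 1) := rep_mem_vanishing a ρ hA _ hf
    rw [sum_eq_single_of_mem (g⁻¹ • T) (by simpa using hT)]
    · congr 1
      trans f' y'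
      · simp only [hf', ← hy', SlotAction.rep_apply, smul_inv_smul, inv_inv]
        congr 2
        ext i
        rw [← a.mul_apply, mul_inv_cancel, a.one_apply]
      · refine multilinear_congr _ _ _ fun i z hne hzi hz => ?_
        have hi : i ∉ g⁻¹ • T := fun hi => hne (by simp [cut, hi])
        refine hf'v z (insert i (g⁻¹ • T)) (by rw [card_insert_of_notMem hi, hTg]) ?_
        intro j hj
        rcases mem_insert.1 hj with rfl | hj
        · rw [hzi]; simpa [cut, hi] using hq _
        · have : j ≠ i := fun h => hi (h ▸ hj)
          rcases hz j this with h | h <;> rw [h]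
          · exact hyA j hj
          · exact hcut _ _ _ (hyA j hj)
    · intro T' hT' hne
      simp only [mem_filter, mem_univ, true_and] at hT'
      obtain ⟨i, hi, hi'⟩ : ∃ i ∈ g⁻¹ • T, i ∉ T' := by
        by_contra! h
        exact hne (eq_of_subset_of_card_le h (by omega)).symm
      rw [MultilinearMap.map_coord_zero _ i, map_zero]
      simp [cut, hi', hqA _ (hyA i hi)]

/-- Modulo relative traces, a multilinear map vanishing on `A` in all slots descends to the
quotient by `A`. -/
lemma exists_descent (a : SlotAction R P I B) {ρ : Representation R P X}
    (hX : ProperlyProjective ρ) [MulAction.IsPretransitive P I]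
    {A : Submodule R B} (hA : ∀ g i, ∀ b ∈ A, a.ψ g i b ∈ A)
    (q : B →ₗ[R] B) (hq : ∀ b, q b ∈ A) (hqA : ∀ b ∈ A, q b = b) [Nonempty I] :
    ∃ τ : MultilinearMap R (fun _ : I => B) X →ₗ[R] MultilinearMap R (fun _ : I => B) X,
      (∀ r, ∀ f ∈ vanishing X I A r, τ f ∈ vanishing X I A r) ∧
      ∀ f ∈ vanishing X I A (Fintype.card I),
        f - conjTrace (a.rep ρ) τ f ∈ vanishing X I A 1 := by
  have key : ∀ j, j + 1 ≤ Fintype.card I →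
      ∃ τ : MultilinearMap R (fun _ : I => B) X →ₗ[R] MultilinearMap R (fun _ : I => B) X,
      (∀ r, ∀ f ∈ vanishing X I A r, τ f ∈ vanishing X I A r) ∧
      ∀ f ∈ vanishing X I A (j + 1), f - conjTrace (a.rep ρ) τ f ∈ vanishing X I A 1 := by
    intro j
    induction j with
    | zero =>
      exact fun _ => ⟨0, fun r f _ => by simp, fun f hf => by simpa [conjTrace_apply] using hf⟩
    | succ j ih =>
      intro hj
      obtain ⟨τ, hτ, hτ'⟩ := ih (by omega)
      obtain ⟨σ, hσ, hσ'⟩ := exists_filtration_step (s := j + 1) a hX hA q hq hqA (by omega)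
        (by omega)
      refine ⟨σ + τ ∘ₗ (LinearMap.id - conjTrace (a.rep ρ) σ), fun r f hf => ?_, fun f hf => ?_⟩
      · exact add_mem (hσ r f hf) (hτ r _ (sub_mem hf (conjTrace_mem_vanishing a ρ hA (hσ r) hf)))
      · convert hτ' _ (hσ' f hf) using 1
        have : conjTrace (a.rep ρ) (σ + τ ∘ₗ (LinearMap.id - conjTrace (a.rep ρ) σ)) f =
            conjTrace (a.rep ρ) σ f +
              conjTrace (a.rep ρ) τ (f - conjTrace (a.rep ρ) σ f) := by
          simp only [conjTrace_apply (a.rep ρ) (σ + _), conjTrace_apply (a.rep ρ) τ,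
            LinearMap.add_apply, LinearMap.comp_apply, LinearMap.sub_apply, LinearMap.id_apply,
            conjTrace_equivariant, map_add, sum_add_distrib, map_sub, conjTrace_apply _ σ f]
        rw [this]; abel
  have := Fintype.card_pos (α := I)
  obtain ⟨n, hn⟩ : ∃ n, Fintype.card I = n + 1 := ⟨Fintype.card I - 1, by omega⟩
  rw [hn]
  exact key n hn.ge

end Slots

section SlotComplexes

variable {R P I X B₀ B₁ : Type*} [CommRing R] [Group P] [MulAction P I]
  [AddCommGroup X] [Module R X] [AddCommGroup B₀] [Module R B₀] [AddCommGroup B₁] [Module R B₁]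

variable (R P I B₀ B₁) in
/-- A split augmented complex `B₁ → B₀ → R` whose tensor power over `I` carries an action. -/
structure SlotComplex where
  /-- the action in degree zero -/
  a₀ : SlotAction R P I B₀
  /-- the action in degree one -/
  a₁ : SlotAction R P I B₁
  /-- the boundary -/
  bd : B₁ →ₗ[R] B₀
  /-- the augmentation -/
  ε : B₀ →ₗ[R] R
  /-- a base point -/
  e₀ : B₀
  /-- a partial section of the boundary -/
  σ : B₀ →ₗ[R] B₁
  bd_equivariant : ∀ g i b, bd (a₁.ψ g i b) = a₀.ψ g i (bd b)
  ε_equivariant : ∀ g i b, ε (a₀.ψ g i b) = ε b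
  ε_bd : ∀ b, ε (bd b) = 0
  ε_e₀ : ε e₀ = 1
  bd_σ : ∀ b, ε b = 0 → bd (σ b) = b

namespace SlotComplex

variable (D : SlotComplex R P I B₀ B₁)

lemma mem_vanishing_card [Fintype I] {B : Type*} [AddCommGroup B] [Module R B]
    {A : Submodule R B} {f : MultilinearMap R (fun _ : I => B) X} :
    f ∈ vanishing X I A (Fintype.card I) ↔ ∀ y : I → B, (∀ i, y i ∈ A) → f y = 0 := by
  refine ⟨fun hf y hy => hf y univ card_univ fun i _ => hy i, fun hf y T hT hy => hf y fun i => ?_⟩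
  exact hy i ((card_eq_iff_eq_univ T).1 hT ▸ mem_univ i)

lemma mem_vanishing_one {B : Type*} [AddCommGroup B] [Module R B]
    {A : Submodule R B} {f : MultilinearMap R (fun _ : I => B) X} :
    f ∈ vanishing X I A 1 ↔ ∀ (y : I → B) (i : I), y i ∈ A → f y = 0 := by
  refine ⟨fun hf y i hy => hf y {i} rfl (by simpa using hy), fun hf y T hT hy => ?_⟩
  obtain ⟨i, rfl⟩ := card_eq_one.1 hT
  exact hf y i (by simpa using hy)

lemma range_ι [Fintype I] [DecidableEq I] {f : MultilinearMap R (fun _ : I => B₀) X} :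
    f ∈ vanishing X I (LinearMap.ker D.ε) 1 ↔ ∃ x, f = prodSmul (fun _ => D.ε) x := by
  rw [mem_vanishing_one]
  constructor
  · intro hf
    refine ⟨f fun _ => D.e₀, MultilinearMap.ext fun (y : I → B₀) => ?_⟩
    rw [prodSmul_apply, ← f.map_smul_univ]
    refine multilinear_congr f _ _ fun i z _ hz _ => hf z i ?_
    rw [hz, LinearMap.mem_ker, map_sub, map_smul, D.ε_e₀, smul_eq_mul, mul_one, sub_self]
  · rintro ⟨x, rfl⟩ y i hy
    rw [prodSmul_apply, prod_eq_zero (mem_univ i) (LinearMap.mem_ker.1 hy), zero_smul]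

lemma range_d [Fintype I] [DecidableEq I] {f : MultilinearMap R (fun _ : I => B₁) X} :
    f ∈ vanishing X I (LinearMap.ker D.bd) 1 ↔ ∃ x, f = pull 1 (fun _ => D.bd) x := by
  rw [mem_vanishing_one]
  constructor
  · intro hf
    refine ⟨pull 1 (fun _ => D.σ) f, MultilinearMap.ext fun (y : I → B₁) => ?_⟩
    refine multilinear_congr f _ _ fun i z _ hz _ => hf z i ?_
    rw [hz, LinearMap.mem_ker, map_sub]
    exact sub_eq_zero.2 (D.bd_σ _ (D.ε_bd _)).symm
  · rintro ⟨x, rfl⟩ y i hy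
    exact x.map_coord_zero i hy

lemma ker_d [Fintype I] {f : MultilinearMap R (fun _ : I => B₀) X} :
    f ∈ vanishing X I (LinearMap.ker D.ε) (Fintype.card I) ↔ pull 1 (fun _ => D.bd) f = 0 := by
  rw [mem_vanishing_card]
  constructor
  · exact fun hf => MultilinearMap.ext fun y => hf _ fun i => D.ε_bd _
  · intro hf y hy
    rw [← _root_.zero_apply (F := MultilinearMap R (fun _ : I => B₁) X) fun i => D.σ (y i), ← hf]
    exact congrArg f (funext fun i => (D.bd_σ _ (hy i)).symm)

lemma ker_ε_stable (g : P) (i : I) : ∀ b ∈ LinearMap.ker D.ε, D.a₀.ψ g i b ∈ LinearMap.ker D.ε := by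
  intro b hb
  rwa [LinearMap.mem_ker, D.ε_equivariant]

lemma ker_bd_stable (g : P) (i : I) :
    ∀ b ∈ LinearMap.ker D.bd, D.a₁.ψ g i b ∈ LinearMap.ker D.bd := by
  intro b hb
  rw [LinearMap.mem_ker, D.bd_equivariant, LinearMap.mem_ker.1 hb, map_zero]

variable [Fintype I] {ρ : Representation R P X}

lemma exists_τ₀ [Fintype P] [DecidableEq I] [MulAction.IsPretransitive P I] [Nonempty I]
    (hX : ProperlyProjective ρ) :
    ∃ τ : MultilinearMap R (fun _ : I => B₀) X →ₗ[R] MultilinearMap R (fun _ : I => B₀) X,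
    (∀ r, ∀ f ∈ vanishing X I (LinearMap.ker D.ε) r, τ f ∈ vanishing X I (LinearMap.ker D.ε) r) ∧
    ∀ f ∈ vanishing X I (LinearMap.ker D.ε) (Fintype.card I),
      f - conjTrace (D.a₀.rep ρ) τ f ∈ vanishing X I (LinearMap.ker D.ε) 1 :=
  exists_descent D.a₀ hX D.ker_ε_stable (LinearMap.id - D.ε.smulRight D.e₀)
    (fun b => by simp [D.ε_e₀]) (fun b hb => by simp [LinearMap.mem_ker.1 hb])

lemma exists_τ₁ [Fintype P] [DecidableEq I] [MulAction.IsPretransitive P I] [Nonempty I]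
    (hX : ProperlyProjective ρ) :
    ∃ τ : MultilinearMap R (fun _ : I => B₁) X →ₗ[R] MultilinearMap R (fun _ : I => B₁) X,
    (∀ r, ∀ f ∈ vanishing X I (LinearMap.ker D.bd) r, τ f ∈ vanishing X I (LinearMap.ker D.bd) r) ∧
    ∀ f ∈ vanishing X I (LinearMap.ker D.bd) (Fintype.card I),
      f - conjTrace (D.a₁.rep ρ) τ f ∈ vanishing X I (LinearMap.ker D.bd) 1 :=
  exists_descent D.a₁ hX D.ker_bd_stable (LinearMap.id - D.σ ∘ₗ D.bd)
    (fun b => by simp [D.bd_σ _ (D.ε_bd b)]) (fun b hb => by simp [LinearMap.mem_ker.1 hb])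

/-- The tensor power of a split complex, applied to a properly projective module. -/
def twoStep [Fintype P] [DecidableEq I] [MulAction.IsPretransitive P I] [Nonempty I]
    (hX : ProperlyProjective ρ) : TwoStep ρ (MultilinearMap R (fun _ : I => B₀) X)
    (MultilinearMap R (fun _ : I => B₁) X) where
  ρ₀ := D.a₀.rep ρ
  ρ₁ := D.a₁.rep ρ
  ι := prodSmul fun _ => D.ε
  d := pull 1 fun _ => D.bd
  K₁ := vanishing X I (LinearMap.ker D.bd) (Fintype.card I)
  τ₀ := (D.exists_τ₀ hX).choose
  τ₁ := (D.exists_τ₁ hX).choose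
  ι_equivariant g x := by
    refine MultilinearMap.ext fun (y : I → B₀) => ?_
    rw [SlotAction.rep_apply, prodSmul_apply, prodSmul_apply, map_smul]
    simp only [D.ε_equivariant]
    congr 1
    exact (Fintype.prod_equiv (MulAction.toPerm g) _ _ fun _ => rfl).symm
  d_equivariant g x := pull_equivariant D.a₁ D.a₀ ρ 1 _ (fun _ _ => rfl)
    (fun g i b => (D.bd_equivariant g i b).symm) g x
  K₁_stable g x hx := rep_mem_vanishing _ _ D.ker_bd_stable g hx
  ι_injective x y h := by
    have := congrArg (fun f => f fun _ => D.e₀) h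
    simpa [D.ε_e₀] using this
  d_ι x := by
    obtain ⟨i⟩ := ‹Nonempty I›
    refine MultilinearMap.ext fun (y : I → B₁) => ?_
    rw [pull_apply, prodSmul_apply, prod_eq_zero (mem_univ i) (D.ε_bd _), zero_smul]
    rfl
  τ₀_ker x hx := D.ker_d.1 ((D.exists_τ₀ hX).choose_spec.1 _ x (D.ker_d.2 hx))
  τ₀_range x := D.range_ι.1 ((D.exists_τ₀ hX).choose_spec.1 _ _ (D.range_ι.2 ⟨x, rfl⟩))
  τ₀_spec x hx := D.range_ι.1 ((D.exists_τ₀ hX).choose_spec.2 x (D.ker_d.2 hx))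
  τ₁_K₁ x hx := (D.exists_τ₁ hX).choose_spec.1 _ x hx
  τ₁_range x := D.range_d.1 ((D.exists_τ₁ hX).choose_spec.1 _ _ (D.range_d.2 ⟨x, rfl⟩))
  τ₁_spec x hx := D.range_d.1 ((D.exists_τ₁ hX).choose_spec.2 x hx)

/-- A family of cycle functionals permuted by the group gives an equivariant family of multilinear
maps, up to maps vanishing on cycles. -/
lemma rep_prodSmul_sub_mem {T : Type*} [MulAction P T] (Θ : T → I → B₁ →ₗ[R] R)
    (hΘ : ∀ (g : P) t i b, D.bd b = 0 → Θ (g • t) (g • i) (D.a₁.ψ g i b) = Θ t i b)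
    (g : P) (t : T) (m : X) :
    D.a₁.rep ρ g (prodSmul (Θ t) m) - prodSmul (Θ (g • t)) (ρ g m) ∈
      vanishing X I (LinearMap.ker D.bd) (Fintype.card I) := by
  rw [mem_vanishing_card]
  intro y hy
  rw [_root_.sub_apply, sub_eq_zero, SlotAction.rep_apply, prodSmul_apply, prodSmul_apply, map_smul]
  congr 1
  refine Fintype.prod_equiv (MulAction.toPerm g) _ _ fun i => ?_
  have := hΘ g⁻¹ (g • t) (g • i) (y (g • i)) (hy _)
  rwa [inv_smul_smul, inv_smul_smul] at this

lemma sum_prodSmul_mem [Fintype P] (hX : ProperlyProjective ρ) {T : Type*} [MulAction P T]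
    (Θ : T → I → B₁ →ₗ[R] R)
    (hΘ : ∀ (g : P) t i b, D.bd b = 0 → Θ (g • t) (g • i) (D.a₁.ψ g i b) = Θ t i b)
    (s : Finset T) (hs : ∀ (g : P), ∀ t ∈ s, g • t ∈ s)
    (hst : ∀ t ∈ s, MulAction.stabilizer P t ≠ ⊤) {m : X} (hm : norm ρ m = 0) :
    ∃ k ∈ vanishing X I (LinearMap.ker D.bd) (Fintype.card I),
      ∑ t ∈ s, prodSmul (Θ t) m - k ∈ Coinvariants.ker (D.a₁.rep ρ) := by
  obtain ⟨t, ht⟩ := hX.exists_family T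
  have key := sum_mem_ker ρ (D.a₁.rep ρ) (∑ a ∈ s, prodSmul (Θ a) ∘ₗ t a) hm
  set V := ∑ g, (D.a₁.rep ρ g) ((∑ a ∈ s, prodSmul (Θ a) ∘ₗ t a) (ρ g⁻¹ m)) with hV
  refine ⟨∑ a ∈ s, prodSmul (Θ a) m - V, ?_, by rwa [sub_sub_cancel]⟩
  have h1 : ∑ a ∈ s, prodSmul (Θ a) m =
      ∑ g, ∑ a ∈ s, prodSmul (Θ (g • a)) (ρ g (t a (ρ g⁻¹ m))) := by
    rw [sum_congr rfl fun a ha => by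
      rw [← ht a (hst a ha) m, map_sum], sum_comm]
    refine sum_congr rfl fun g _ => ?_
    refine sum_bij' (fun a _ => g⁻¹ • a) (fun a _ => g • a) (fun a ha => hs _ a ha)
      (fun a ha => hs _ a ha) (by simp) (by simp) fun a ha => ?_
    rw [smul_inv_smul]
  rw [h1, hV, ← sum_sub_distrib]
  refine Submodule.sum_mem _ fun g _ => ?_
  simp only [LinearMap.sum_apply, LinearMap.comp_apply, map_sum]
  rw [← sum_sub_distrib]
  refine Submodule.sum_mem _ fun a _ => ?_
  rw [← neg_sub]
  exact neg_mem (D.rep_prodSmul_sub_mem Θ hΘ g a _)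

/-- Slotwise functionals which are equivariant on cycles. -/
def IsCycleClass (Θ : I → B₁ →ₗ[R] R) : Prop :=
  ∀ (g : P) i b, D.bd b = 0 → Θ (g • i) (D.a₁.ψ g i b) = Θ i b

/-- Additivity of the tensor power of a class, up to transfers from proper subgroups. -/
lemma prodSmul_add_mem [Fintype P] [DecidableEq I] [MulAction.IsPretransitive P I] [Nonempty I]
    (hX : ProperlyProjective ρ) {Θ Θ' : I → B₁ →ₗ[R] R} (hΘ : D.IsCycleClass Θ)
    (hΘ' : D.IsCycleClass Θ') {m : X} (hm : norm ρ m = 0) :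
    ∃ k ∈ vanishing X I (LinearMap.ker D.bd) (Fintype.card I),
      prodSmul (fun i => Θ i + Θ' i) m - prodSmul Θ m - prodSmul Θ' m - k ∈
        Coinvariants.ker (D.a₁.rep ρ) := by
  let Ξ : Finset I → I → B₁ →ₗ[R] R := fun T i => if i ∈ T then Θ i else Θ' i
  have hΞ : ∀ (g : P) T i b, D.bd b = 0 → Ξ (g • T) (g • i) (D.a₁.ψ g i b) = Ξ T i b := by
    intro g T i b hb
    simp only [Ξ, smul_mem_smul_finset_iff]
    split_ifs
    · exact hΘ g i b hb
    · exact hΘ' g i b hb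
  let s : Finset (Finset I) := univ.erase univ |>.erase ∅
  have hs : ∀ g : P, ∀ T ∈ s, g • T ∈ s := by
    intro g T hT
    simp only [s, mem_erase, mem_univ, and_true, ne_eq] at hT ⊢
    refine ⟨fun h => hT.1 (by simpa using h), fun h => hT.2 ?_⟩
    rw [← inv_smul_smul g T, h, smul_finset_univ]
  have hst : ∀ T ∈ s, MulAction.stabilizer P T ≠ ⊤ := by
    intro T hT htop
    simp only [s, mem_erase, mem_univ, and_true, ne_eq] at hT
    obtain ⟨i, hi⟩ := nonempty_iff_ne_empty.2 hT.1
    refine hT.2 (eq_univ_of_forall fun j => ?_)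
    obtain ⟨g, rfl⟩ := MulAction.exists_smul_eq P i j
    have hg : g • T = T := MulAction.mem_stabilizer_iff.1 (htop ▸ Subgroup.mem_top g)
    rw [← hg]
    exact smul_mem_smul_finset hi
  obtain ⟨k, hk, hk'⟩ := D.sum_prodSmul_mem hX Ξ hΞ s hs hst hm
  refine ⟨k, hk, ?_⟩
  convert hk' using 2
  have hne : (∅ : Finset I) ≠ univ := (univ_nonempty.ne_empty).symm
  have h1 : ∑ T ∈ univ, prodSmul (Ξ T) m = prodSmul (fun i => Θ i + Θ' i) m := by
    refine MultilinearMap.ext fun (y : I → B₁) => ?_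
    rw [_root_.sum_apply, prodSmul_apply]
    simp only [prodSmul_apply, LinearMap.add_apply]
    rw [← sum_smul, prod_add, powerset_univ]
    congr 1
    refine sum_congr rfl fun T _ => ?_
    rw [← prod_mul_prod_compl T, compl_eq_univ_sdiff]
    congr 1
    · exact prod_congr rfl fun i hi => by simp [Ξ, hi]
    · exact prod_congr rfl fun i hi => by simp [Ξ, (mem_sdiff.1 hi).2]
  have h2 : Ξ univ = Θ := by ext; simp [Ξ]
  have h3 : Ξ ∅ = Θ' := by ext; simp [Ξ]
  rw [← h1, ← add_sum_erase univ _ (mem_univ (univ : Finset I)), h2, add_sub_cancel_left,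
    ← add_sum_erase (univ.erase univ) _ (mem_erase.2 ⟨hne, mem_univ _⟩), h3, add_sub_cancel_left]

lemma IsCycleClass.rep_sub_mem {D : SlotComplex R P I B₀ B₁} {Θ : I → B₁ →ₗ[R] R}
    (hΘ : D.IsCycleClass Θ) (g : P) (m : X) :
    D.a₁.rep ρ g (prodSmul Θ m) - prodSmul Θ (ρ g m) ∈
      vanishing X I (LinearMap.ker D.bd) (Fintype.card I) := by
  exact D.rep_prodSmul_sub_mem (T := PUnit.{1}) (fun _ => Θ) (fun g _ i b hb => hΘ g i b hb) g ⟨⟩ m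

lemma IsCycleClass.exists_connects [Fintype P] [DecidableEq I] [MulAction.IsPretransitive P I]
    [Nonempty I] (hX : ProperlyProjective ρ) {D : SlotComplex R P I B₀ B₁} {Θ : I → B₁ →ₗ[R] R}
    (hΘ : D.IsCycleClass Θ) {m : X} (hm : norm ρ m = 0) :
    ∃ z, (D.twoStep hX).Connects (prodSmul Θ m) z := by
  refine (D.twoStep hX).exists_connects ?_
  have : norm (D.a₁.rep ρ) (prodSmul Θ m) =
      ∑ g, (D.a₁.rep ρ g (prodSmul Θ m) - prodSmul Θ (ρ g m)) := by
    rw [sum_sub_distrib, ← map_sum, ← norm_apply, ← norm_apply, hm, map_zero, sub_zero]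
  change norm (D.a₁.rep ρ) (prodSmul Θ m) ∈ vanishing X I (LinearMap.ker D.bd) (Fintype.card I)
  rw [this]
  exact Submodule.sum_mem _ fun g _ => hΘ.rep_sub_mem g m

lemma IsCycleClass.exists_ker_sub_mem {D : SlotComplex R P I B₀ B₁} {Θ : I → B₁ →ₗ[R] R}
    (hΘ : D.IsCycleClass Θ) {m : X} (hm : m ∈ Coinvariants.ker ρ) :
    ∃ k ∈ vanishing X I (LinearMap.ker D.bd) (Fintype.card I),
      prodSmul Θ m - k ∈ Coinvariants.ker (D.a₁.rep ρ) := by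
  induction hm using Submodule.span_induction with
  | mem x h =>
    obtain ⟨⟨g, x⟩, rfl⟩ := h
    refine ⟨_, neg_mem (hΘ.rep_sub_mem (ρ := ρ) g x), ?_⟩
    convert Coinvariants.sub_mem_ker g (prodSmul Θ x) using 1
    rw [map_sub]; abel
  | zero => exact ⟨0, zero_mem _, by simp⟩
  | add x y _ _ hx hy =>
    obtain ⟨k, hk, hk'⟩ := hx
    obtain ⟨l, hl, hl'⟩ := hy
    refine ⟨k + l, add_mem hk hl, ?_⟩
    convert add_mem hk' hl' using 1
    rw [map_add]; abel
  | smul a x _ hx =>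
    obtain ⟨k, hk, hk'⟩ := hx
    refine ⟨a • k, Submodule.smul_mem _ a hk, ?_⟩
    convert Submodule.smul_mem _ a hk' using 1
    rw [map_smul, smul_sub]

end SlotComplex

end SlotComplexes

section Graphs

variable {P I X : Type*} [Group P] [MulAction P I] [AddCommGroup X]

variable (P I) in
/-- The augmented chain complex of the complete directed graph on `P`. -/
def completeGraphComplex : SlotComplex ℤ P I (P →₀ ℤ) (P × P →₀ ℤ) where
  a₀ :=
    { ψ g _ := Finsupp.lmapDomain ℤ ℤ (g * ·)
      one_apply i b := by simp; exact Finsupp.mapDomain_id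
      mul_apply g h i b := by
        simp only [Finsupp.lmapDomain_apply, ← Finsupp.mapDomain_comp]
        congr 1; ext x; simp [mul_assoc] }
  a₁ :=
    { ψ g _ := Finsupp.lmapDomain ℤ ℤ (fun e => (g * e.1, g * e.2))
      one_apply i b := by simp; exact Finsupp.mapDomain_id
      mul_apply g h i b := by
        simp only [Finsupp.lmapDomain_apply, ← Finsupp.mapDomain_comp]
        congr 1; ext x <;> simp [mul_assoc] }
  bd := Finsupp.linearCombination ℤ fun e => Finsupp.single e.2 1 - Finsupp.single e.1 1
  ε := Finsupp.linearCombination ℤ fun _ => 1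
  e₀ := Finsupp.single 1 1
  σ := Finsupp.linearCombination ℤ fun x => Finsupp.single (1, x) 1
  bd_equivariant g i b := by
    induction b using Finsupp.induction_linear with
    | zero => simp
    | add x y hx hy => rw [map_add, map_add, map_add, map_add, hx, hy]
    | single e n =>
      have := (Finsupp.lmapDomain ℤ ℤ (g * ·)).map_sub (Finsupp.single e.2 n)
        (Finsupp.single e.1 n)
      simp only [Finsupp.lmapDomain_apply] at this
      simp [Finsupp.mapDomain_single, smul_sub, this]
  ε_equivariant g i b := by
    induction b using Finsupp.induction_linear with
    | zero => simp
    | add x y hx hy => rw [map_add, map_add, map_add, hx, hy]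
    | single e n => simp [Finsupp.mapDomain_single]
  ε_bd b := by
    induction b using Finsupp.induction_linear with
    | zero => simp
    | add x y hx hy => rw [map_add, map_add, hx, hy, add_zero]
    | single e n => simp
  ε_e₀ := by simp
  bd_σ b hb := by
    have : ∀ b : P →₀ ℤ, (Finsupp.linearCombination ℤ fun e : P × P => (Finsupp.single e.2 (1 : ℤ) -
        Finsupp.single e.1 1 : P →₀ ℤ)) (Finsupp.linearCombination ℤ (fun x : P =>
        (Finsupp.single (1, x) 1 : P × P →₀ ℤ)) b) = b - Finsupp.linearCombination ℤ
        (fun _ => (1 : ℤ)) b • Finsupp.single 1 1 := fun b => by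
      induction b using Finsupp.induction_linear with
      | zero => simp
      | add x y hx hy => rw [map_add, map_add, map_add, hx, hy, add_smul]; abel
      | single e n => simp [smul_sub]
    rw [this, hb, zero_smul, sub_zero]

variable {N : ℕ}

variable (P I N) in
/-- An additive cocycle with values in functions `I → ZMod N`. -/
structure SlotCocycle where
  /-- the cocycle -/
  w : P → I → ZMod N
  mul_apply : ∀ g h i, w (g * h) i = w g (h • i) + w h i

lemma SlotCocycle.one_apply (c : SlotCocycle P I N) (i : I) : c.w 1 i = 0 := by
  have := c.mul_apply 1 1 i
  simpa using this

/-- Translation by a slot cocycle. -/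
def SlotCocycle.action (c : SlotCocycle P I N) : SlotAction ℤ P I (ZMod N →₀ ℤ) where
  ψ g i := Finsupp.lmapDomain ℤ ℤ (· + c.w g i)
  one_apply i b := by simp [c.one_apply]; exact Finsupp.mapDomain_id
  mul_apply g h i b := by
    simp only [Finsupp.lmapDomain_apply, ← Finsupp.mapDomain_comp]
    congr 1; ext x; simp [c.mul_apply]; ring

/-- The boundary of the directed cycle of length `N`. -/
def cycleBd (N : ℕ) : (ZMod N →₀ ℤ) →ₗ[ℤ] (ZMod N →₀ ℤ) :=
  Finsupp.linearCombination ℤ fun c => Finsupp.single (c + 1) 1 - Finsupp.single c 1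

/-- The path of length `n` starting at the base point of the cycle. -/
def cyclePath (N n : ℕ) : ZMod N →₀ ℤ := ∑ j ∈ range n, Finsupp.single (j : ZMod N) 1

lemma cycleBd_cyclePath (n : ℕ) :
    cycleBd N (cyclePath N n) = Finsupp.single (n : ZMod N) 1 - Finsupp.single 0 1 := by
  induction n with
  | zero => simp [cyclePath]
  | succ n ih =>
    rw [cyclePath, sum_range_succ, map_add]
    change cycleBd N (cyclePath N n) + _ = _
    rw [ih]; simp [cycleBd]

lemma cycleBd_translate (a : ZMod N) (b : ZMod N →₀ ℤ) :
    cycleBd N (Finsupp.mapDomain (· + a) b) = Finsupp.mapDomain (· + a) (cycleBd N b) := by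
  induction b using Finsupp.induction_linear with
  | zero => simp
  | add x y hx hy => rw [Finsupp.mapDomain_add, map_add, map_add, Finsupp.mapDomain_add, hx, hy]
  | single e n =>
    have := (Finsupp.lmapDomain ℤ ℤ (· + a)).map_sub (Finsupp.single (e + 1) n)
      (Finsupp.single e n)
    simp only [Finsupp.lmapDomain_apply] at this
    simp [cycleBd, Finsupp.mapDomain_single, smul_sub, this, add_right_comm]

lemma cycleBd_apply (b : ZMod N →₀ ℤ) (c : ZMod N) : cycleBd N b c = b (c - 1) - b c := by
  induction b using Finsupp.induction_linear with
  | zero => simp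
  | add x y hx hy => rw [map_add, Finsupp.add_apply, hx, hy]; simp; ring
  | single e n =>
    simp [cycleBd, Finsupp.single_apply, mul_sub, eq_sub_iff_add_eq]

/-- The total length of a chain in the cycle. -/
def chainLength (N : ℕ) : (ZMod N →₀ ℤ) →ₗ[ℤ] ℤ := Finsupp.linearCombination ℤ fun _ => 1

lemma chainLength_translate (a : ZMod N) (b : ZMod N →₀ ℤ) :
    chainLength N (Finsupp.mapDomain (· + a) b) = chainLength N b := by
  induction b using Finsupp.induction_linear with
  | zero => simp
  | add x y hx hy => rw [Finsupp.mapDomain_add, map_add, map_add, hx, hy]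
  | single e n => simp [Finsupp.mapDomain_single, chainLength]

variable [NeZero N]

/-- The augmented chain complex of a directed cycle. -/
def SlotCocycle.cycleComplex (c : SlotCocycle P I N) :
    SlotComplex ℤ P I (ZMod N →₀ ℤ) (ZMod N →₀ ℤ) where
  a₀ := c.action
  a₁ := c.action
  bd := cycleBd N
  ε := Finsupp.linearCombination ℤ fun _ => 1
  e₀ := Finsupp.single 0 1
  σ := Finsupp.linearCombination ℤ fun c => cyclePath N c.val
  bd_equivariant g i b := cycleBd_translate _ b
  ε_equivariant g i b := by
    induction b using Finsupp.induction_linear with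
    | zero => simp
    | add x y hx hy => rw [map_add, map_add, map_add, hx, hy]
    | single e n => simp [SlotCocycle.action, Finsupp.mapDomain_single]
  ε_bd b := by
    induction b using Finsupp.induction_linear with
    | zero => simp
    | add x y hx hy => rw [map_add, map_add, hx, hy, add_zero]
    | single e n => simp [cycleBd]
  ε_e₀ := by simp
  bd_σ b hb := by
    have : ∀ b : ZMod N →₀ ℤ, cycleBd N (Finsupp.linearCombination ℤ (fun x : ZMod N =>
        cyclePath N x.val) b) = b - Finsupp.linearCombination ℤ
        (fun _ => (1 : ℤ)) b • Finsupp.single 0 1 := fun b => by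
      induction b using Finsupp.induction_linear with
      | zero => simp
      | add x y hx hy => rw [map_add, map_add, map_add, hx, hy, add_smul]; abel
      | single e n =>
        rw [Finsupp.linearCombination_single, map_smul, cycleBd_cyclePath]; simp [smul_sub]
    rw [this, hb, zero_smul, sub_zero]

/-- The fundamental cycle. -/
def fundamentalCycle (N : ℕ) [NeZero N] : ZMod N →₀ ℤ := Finsupp.equivFunOnFinite.symm 1

@[simp]
lemma fundamentalCycle_apply (c : ZMod N) : fundamentalCycle N c = 1 := rfl

lemma fundamentalCycle_eq_sum : fundamentalCycle N = ∑ c, Finsupp.single c 1 := by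
  ext a
  simp [Finsupp.finsetSum_apply, Finsupp.single_apply]

lemma translate_fundamentalCycle (a : ZMod N) :
    Finsupp.mapDomain (· + a) (fundamentalCycle N) = fundamentalCycle N := by
  rw [fundamentalCycle_eq_sum, Finsupp.mapDomain_finsetSum]
  simp only [Finsupp.mapDomain_single]
  exact Fintype.sum_equiv (Equiv.addRight a) _ _ fun _ => rfl

lemma cycleBd_fundamentalCycle : cycleBd N (fundamentalCycle N) = 0 := by
  rw [fundamentalCycle_eq_sum, map_sum]
  simp only [cycleBd, Finsupp.linearCombination_single, one_smul]
  rw [sum_sub_distrib, sub_eq_zero]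
  exact Fintype.sum_equiv (Equiv.addRight 1) _ _ fun _ => rfl

lemma eq_smul_fundamentalCycle {b : ZMod N →₀ ℤ} (hb : cycleBd N b = 0) :
    b = b 0 • fundamentalCycle N := by
  have h : ∀ n : ℕ, b (n : ZMod N) = b 0 := fun n => by
    induction n with
    | zero => simp
    | succ n ih =>
      have := cycleBd_apply b ((n + 1 : ℕ) : ZMod N)
      rw [hb] at this
      simp only [Finsupp.coe_zero, Pi.zero_apply, Nat.cast_add, Nat.cast_one,
        add_sub_cancel_right] at this
      rw [← ih]; push_cast; linarith
  ext c
  have := h c.val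
  rw [ZMod.natCast_zmod_val] at this
  simp [this]

/-- A path of signed length `n` from the base point of the cycle to `n`. -/
def cycleArc (N : ℕ) [NeZero N] (n : ℤ) : ZMod N →₀ ℤ :=
  cyclePath N (n % N).toNat + (n / N) • fundamentalCycle N

lemma cycleBd_cycleArc (n : ℤ) :
    cycleBd N (cycleArc N n) = Finsupp.single (n : ZMod N) 1 - Finsupp.single 0 1 := by
  have h : (((n % N).toNat : ℕ) : ZMod N) = n := by
    have h0 : 0 ≤ n % N := Int.emod_nonneg _ (by exact_mod_cast NeZero.ne N)
    have : (((n % N).toNat : ℤ) : ZMod N) = n := by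
      rw [Int.toNat_of_nonneg h0, ZMod.intCast_mod]
    exact_mod_cast this
  rw [cycleArc, map_add, map_smul, cycleBd_fundamentalCycle, cycleBd_cyclePath, smul_zero,
    add_zero, h]

lemma chainLength_fundamentalCycle : chainLength N (fundamentalCycle N) = N := by
  simp [chainLength, fundamentalCycle_eq_sum]

lemma chainLength_cycleArc (n : ℤ) : chainLength N (cycleArc N n) = n := by
  have h0 : 0 ≤ n % N := Int.emod_nonneg _ (by exact_mod_cast NeZero.ne N)
  rw [cycleArc, map_add, map_smul, chainLength_fundamentalCycle, cyclePath, map_sum]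
  simp only [chainLength, Finsupp.linearCombination_single, smul_eq_mul, mul_one, sum_const,
    card_range, nsmul_eq_mul, Int.toNat_of_nonneg h0]
  rw [mul_comm]
  exact Int.emod_add_mul_ediv n N

section WeakProjectivity

variable [Fintype P] [Fintype I] [DecidableEq I] {ρ : Representation ℤ P X}

/-- The affine action on `I → ZMod N` defined by a slot cocycle. -/
@[reducible]
def SlotCocycle.mulAction (c : SlotCocycle P I N) : MulAction P (I → ZMod N) where
  smul g d := fun i => d (g⁻¹ • i) + c.w g (g⁻¹ • i)
  one_smul d := by
    funext i
    change d ((1 : P)⁻¹ • i) + c.w 1 ((1 : P)⁻¹ • i) = d i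
    simp [c.one_apply]
  mul_smul g h d := by
    funext i
    change d ((g * h)⁻¹ • i) + c.w (g * h) ((g * h)⁻¹ • i) =
      d (h⁻¹ • g⁻¹ • i) + c.w h (h⁻¹ • g⁻¹ • i) + c.w g (g⁻¹ • i)
    rw [mul_inv_rev, mul_smul, c.mul_apply, smul_inv_smul]
    ring

/-- A slot cocycle is fixed point free if its affine action has no fixed point. -/
def SlotCocycle.FixedPointFree (c : SlotCocycle P I N) : Prop :=
  ∀ d : I → ZMod N, ∃ g i, d (g • i) ≠ d i + c.w g i

/-- Multilinear maps on a cycle with a fixed point free action form a weakly projective module. -/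
lemma SlotCocycle.exists_conjTrace_eq (c : SlotCocycle P I N) (hc : c.FixedPointFree)
    (hX : ProperlyProjective ρ) :
    ∃ s : MultilinearMap ℤ (fun _ : I => ZMod N →₀ ℤ) X →ₗ[ℤ]
      MultilinearMap ℤ (fun _ : I => ZMod N →₀ ℤ) X,
      ∀ f, conjTrace (c.action.rep ρ) s f = f := by
  let _ := c.mulAction
  obtain ⟨t, ht⟩ := hX.exists_family (I → ZMod N)
  have hstab : ∀ d : I → ZMod N, MulAction.stabilizer P d ≠ ⊤ := fun d htop => by
    obtain ⟨g, i, hgi⟩ := hc d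
    have hg : g • d = d := MulAction.mem_stabilizer_iff.1 (htop ▸ Subgroup.mem_top g)
    refine hgi ?_
    conv_lhs => rw [← hg]
    change d (g⁻¹ • g • i) + c.w g (g⁻¹ • g • i) = _
    rw [inv_smul_smul]
  let ev : (I → ZMod N) → MultilinearMap ℤ (fun _ : I => ZMod N →₀ ℤ) X →ₗ[ℤ] X := fun d =>
    { toFun f := f fun i => Finsupp.single (d i) 1
      map_add' _ _ := rfl
      map_smul' _ _ := rfl }
  let s : MultilinearMap ℤ (fun _ : I => ZMod N →₀ ℤ) X →ₗ[ℤ]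
      MultilinearMap ℤ (fun _ : I => ZMod N →₀ ℤ) X :=
    ∑ d, prodSmul (fun i => Finsupp.lapply (d i)) ∘ₗ t d ∘ₗ ev d
  have hs : ∀ f (d : I → ZMod N), s f (fun i => Finsupp.single (d i) 1) =
      t d (f fun i => Finsupp.single (d i) 1) := fun f d => by
    simp only [s, LinearMap.sum_apply, _root_.sum_apply, LinearMap.comp_apply, prodSmul_apply]
    rw [sum_eq_single d]
    · simp [ev]
    · intro d' _ hd
      obtain ⟨i, hi⟩ := Function.ne_iff.1 hd
      rw [prod_eq_zero (mem_univ i), zero_smul]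
      simp [hi.symm]
    · simp
  refine ⟨s, fun f => ?_⟩
  refine Module.Basis.ext_multilinear (fun _ => Finsupp.basisSingleOne) fun d => ?_
  simp only [Finsupp.coe_basisSingleOne]
  rw [conjTrace_apply, _root_.sum_apply, ← ht d (hstab d) (f _)]
  refine sum_congr rfl fun g _ => ?_
  have hgd : (fun i => c.action.ψ g⁻¹ (g • i) (Finsupp.single (d (g • i)) 1)) =
      fun i => Finsupp.single ((g⁻¹ • d) i) 1 := by
    funext i
    change Finsupp.mapDomain _ _ = Finsupp.single (d (g⁻¹⁻¹ • i) + c.w g⁻¹ (g⁻¹⁻¹ • i)) 1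
    rw [Finsupp.mapDomain_single, inv_inv]
  rw [SlotAction.rep_apply, hgd, hs, ← hgd, SlotAction.rep_apply]
  congr 4
  funext i
  have := c.action.mul_apply g g⁻¹ i
  simp only [smul_inv_smul, inv_inv, ← this, mul_inv_cancel, c.action.one_apply]

end WeakProjectivity

end Graphs

section CycleClasses

variable {P I X : Type*} [Group P] [MulAction P I] [AddCommGroup X] {N : ℕ}

variable (P I N) in
/-- A slotwise family of equivariant maps from the complete graph on `P` to a cycle of
length `N`. -/
structure CycleData where
  /-- the cocycle describing the rotations of the cycles -/
  w : P → I → ZMod N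
  /-- the map on vertices -/
  Γ : I → P → ZMod N
  /-- the lengths of the images of the edges -/
  len : I → P → P → ℤ
  Γ_smul : ∀ g i x, Γ (g • i) (g * x) = Γ i x + w g i
  len_smul : ∀ g i x y, len (g • i) (g * x) (g * y) = len i x y
  len_cast : ∀ i x y, (len i x y : ZMod N) = Γ i y - Γ i x

namespace CycleData

variable (U : CycleData P I N)

/-- The underlying cocycle. -/
def cocycle : SlotCocycle P I N where
  w := U.w
  mul_apply g h i := by
    have h₁ := U.Γ_smul (g * h) i 1
    have h₂ := U.Γ_smul g (h • i) (h * 1)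
    rw [U.Γ_smul h i 1, ← mul_assoc, ← mul_smul] at h₂
    rw [h₁] at h₂
    linear_combination h₂

/-- Reindexing of the slots. -/
@[simps]
def reindex (r : Equiv.Perm I) (hr : ∀ (g : P) i, r (g • i) = g • r i) : CycleData P I N where
  w g i := U.w g (r i)
  Γ i := U.Γ (r i)
  len i := U.len (r i)
  Γ_smul g i x := by rw [hr, U.Γ_smul]
  len_smul g i x y := by rw [hr, U.len_smul]
  len_cast i x y := U.len_cast _ x y

/-- The difference of two families. -/
@[simps]
def sub (V : CycleData P I N) : CycleData P I N where
  w g i := U.w g i - V.w g i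
  Γ i x := U.Γ i x - V.Γ i x
  len i x y := U.len i x y - V.len i x y
  Γ_smul g i x := by rw [U.Γ_smul, V.Γ_smul]; ring
  len_smul g i x y := by rw [U.len_smul, V.len_smul]
  len_cast i x y := by push_cast; rw [U.len_cast, V.len_cast]; ring

/-- The map on vertices. -/
def vertexMap (i : I) : (P →₀ ℤ) →ₗ[ℤ] (ZMod N →₀ ℤ) := Finsupp.lmapDomain ℤ ℤ (U.Γ i)

/-- The total length of the image of a chain. -/
def totalLength (i : I) : (P × P →₀ ℤ) →ₗ[ℤ] ℤ :=
  Finsupp.linearCombination ℤ fun e => U.len i e.1 e.2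

lemma totalLength_smul (g : P) (i : I) (b : P × P →₀ ℤ) :
    U.totalLength (g • i) ((completeGraphComplex P I).a₁.ψ g i b) = U.totalLength i b := by
  induction b using Finsupp.induction_linear with
  | zero => simp
  | add x y hx hy => rw [map_add, map_add, map_add, hx, hy]
  | single e n =>
    simp [completeGraphComplex, totalLength, Finsupp.mapDomain_single, U.len_smul]

lemma vertexMap_smul (g : P) (i : I) (b : P →₀ ℤ) :
    U.vertexMap (g • i) ((completeGraphComplex P I).a₀.ψ g i b) =
      U.cocycle.action.ψ g i (U.vertexMap i b) := by
  simp only [completeGraphComplex, vertexMap, SlotCocycle.action, Finsupp.lmapDomain_apply,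
    ← Finsupp.mapDomain_comp]
  congr 1
  funext x
  simp [cocycle, U.Γ_smul]

variable [NeZero N]

/-- The map on edges. -/
def edgeMap (i : I) : (P × P →₀ ℤ) →ₗ[ℤ] (ZMod N →₀ ℤ) :=
  Finsupp.linearCombination ℤ fun e =>
    Finsupp.mapDomain (· + U.Γ i e.1) (cycleArc N (U.len i e.1 e.2))

lemma edgeMap_smul (g : P) (i : I) (b : P × P →₀ ℤ) :
    U.edgeMap (g • i) ((completeGraphComplex P I).a₁.ψ g i b) =
      U.cocycle.action.ψ g i (U.edgeMap i b) := by
  induction b using Finsupp.induction_linear with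
  | zero => simp
  | add x y hx hy => rw [map_add, map_add, map_add, map_add, hx, hy]
  | single e n =>
    simp only [completeGraphComplex, edgeMap, SlotCocycle.action, Finsupp.lmapDomain_apply,
      Finsupp.mapDomain_single, Finsupp.linearCombination_single, U.len_smul, U.Γ_smul,
      Finsupp.mapDomain_smul, ← Finsupp.mapDomain_comp]
    congr 2
    funext x
    simp [cocycle, add_assoc]

lemma cycleBd_edgeMap (i : I) (b : P × P →₀ ℤ) :
    cycleBd N (U.edgeMap i b) = U.vertexMap i ((completeGraphComplex P I).bd b) := by
  induction b using Finsupp.induction_linear with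
  | zero => simp
  | add x y hx hy => rw [map_add, map_add, map_add, map_add, hx, hy]
  | single e n =>
    have := (Finsupp.lmapDomain ℤ ℤ (· + U.Γ i e.1)).map_sub
      (Finsupp.single (U.len i e.1 e.2 : ZMod N) 1) (Finsupp.single 0 1)
    simp only [Finsupp.lmapDomain_apply] at this
    simp only [completeGraphComplex, edgeMap, Finsupp.linearCombination_single, map_smul,
      cycleBd_translate, cycleBd_cycleArc, this]
    have h := (U.vertexMap i).map_sub (Finsupp.single e.2 1) (Finsupp.single e.1 1)
    rw [h]
    simp [U.len_cast, vertexMap, Finsupp.mapDomain_single]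

lemma chainLength_edgeMap (i : I) (b : P × P →₀ ℤ) :
    chainLength N (U.edgeMap i b) = U.totalLength i b := by
  induction b using Finsupp.induction_linear with
  | zero => simp
  | add x y hx hy => rw [map_add, map_add, map_add, hx, hy]
  | single e n =>
    simp only [edgeMap, Finsupp.linearCombination_single, map_smul, chainLength_translate,
      chainLength_cycleArc, totalLength]

/-- The winding number of a chain. -/
def winding (i : I) : (P × P →₀ ℤ) →ₗ[ℤ] ℤ := Finsupp.lapply 0 ∘ₗ U.edgeMap i

lemma mul_winding (i : I) {b : P × P →₀ ℤ} (hb : (completeGraphComplex P I).bd b = 0) :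
    N * U.winding i b = U.totalLength i b := by
  have h := eq_smul_fundamentalCycle (b := U.edgeMap i b) (by rw [cycleBd_edgeMap, hb, map_zero])
  rw [← chainLength_edgeMap, h, map_smul, chainLength_fundamentalCycle, mul_comm]
  rfl

lemma isCycleClass_winding : (completeGraphComplex P I).IsCycleClass U.winding := by
  intro g i b hb
  refine mul_left_cancel₀ (b := U.winding (g • i) _) (a := (N : ℤ))
    (by exact_mod_cast NeZero.ne N) ?_
  rw [mul_winding, mul_winding _ _ hb, totalLength_smul]
  rw [(completeGraphComplex P I).bd_equivariant, hb, map_zero]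

end CycleData

variable [NeZero N] [Fintype P] [Fintype I] [DecidableEq I] [MulAction.IsPretransitive P I]
  [Nonempty I] {ρ : Representation ℤ P X}

lemma SlotCocycle.mem_ker_of_principal (hX : ProperlyProjective ρ) (c : SlotCocycle P I N)
    (hc : c.FixedPointFree)
    {m : X} {z : P → X}
    (h : (c.cycleComplex.twoStep hX).Connects (prodSmul (fun _ => Finsupp.lapply 0) m) z)
    (x : X) (hx : ∀ g, z g = ρ g x - x) : m ∈ Coinvariants.ker ρ := by
  obtain ⟨s, hs⟩ := c.exists_conjTrace_eq hc hX
  obtain ⟨k, hk, y, hy⟩ := h.exists_of_principal x hx s hs s hs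
  let ev : MultilinearMap ℤ (fun _ : I => ZMod N →₀ ℤ) X →ₗ[ℤ] X :=
    { toFun f := f fun _ => fundamentalCycle N
      map_add' _ _ := rfl
      map_smul' _ _ := rfl }
  have hev : ∀ g f, ev (c.action.rep ρ g f) = ρ g (ev f) := fun g f => by
    change ρ g (f fun i => Finsupp.mapDomain _ (fundamentalCycle N)) = _
    simp only [translate_fundamentalCycle]
    rfl
  have := map_mem_ker _ ρ ev hev hy
  have h₁ : ev k = 0 :=
    hk _ univ card_univ fun i _ => LinearMap.mem_ker.2 cycleBd_fundamentalCycle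
  have h₂ : ev ((c.cycleComplex.twoStep hX).d y) = 0 := by
    change y (fun i => cycleBd N (fundamentalCycle N)) = 0
    rw [cycleBd_fundamentalCycle]
    exact y.map_zero
  rw [map_sub, map_add, h₁, h₂, add_zero, sub_zero] at this
  simpa [ev] using this

namespace CycleData

/-- Transport of the connecting relation from the cycle to the complete graph. -/
lemma connects_winding (hX : ProperlyProjective ρ) (U : CycleData P I N)
    {b : MultilinearMap ℤ (fun _ : I => ZMod N →₀ ℤ) X} {z : P → X}
    (h : (U.cocycle.cycleComplex.twoStep hX).Connects b z) :
    ((completeGraphComplex P I).twoStep hX).Connects (pull 1 U.edgeMap b) z := by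
  refine h.map (pull 1 U.vertexMap) (pull 1 U.edgeMap)
    (fun g f => pull_equivariant _ _ ρ 1 _ (fun _ _ => rfl)
      (fun g i b => (U.vertexMap_smul g i b).symm)
      g f)
    (fun g f => pull_equivariant _ _ ρ 1 _ (fun _ _ => rfl)
      (fun g i b => (U.edgeMap_smul g i b).symm)
      g f) (fun f => ?_) (fun x => ?_) (fun f hf => ?_)
  · refine MultilinearMap.ext fun (y : I → P × P →₀ ℤ) => ?_
    change f (fun i => cycleBd N (U.edgeMap i (y i))) = f fun i => U.vertexMap i _
    simp only [cycleBd_edgeMap]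
    rfl
  · refine MultilinearMap.ext fun (y : I → P →₀ ℤ) => ?_
    change (∏ i, U.cocycle.cycleComplex.ε (U.vertexMap i (y i))) • x =
      (∏ i, (completeGraphComplex P I).ε (y i)) • x
    congr 2 with i
    induction y i using Finsupp.induction_linear with
    | zero => simp
    | add x y hx hy => rw [map_add, map_add, map_add, hx, hy]
    | single e n =>
      simp [vertexMap, Finsupp.mapDomain_single, SlotCocycle.cycleComplex, completeGraphComplex]
  · intro y T hT hy
    refine hf _ T hT fun i hi => LinearMap.mem_ker.2 ?_
    change cycleBd N (U.edgeMap i (y i)) = 0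
    rw [cycleBd_edgeMap, LinearMap.mem_ker.1 (hy i hi), map_zero]

/-- Transport of the connecting relation along a permutation of the slots. -/
lemma connects_reindex (hX : ProperlyProjective ρ) (U : CycleData P I N)
    (r : Equiv.Perm I) (hr : ∀ (g : P) i, r (g • i) = g • r i) {m : X}
    {z : P → X}
    (h : ((completeGraphComplex P I).twoStep hX).Connects (prodSmul U.winding m) z) :
    ((completeGraphComplex P I).twoStep hX).Connects (prodSmul (U.reindex r hr).winding m) z := by
  have hr' : ∀ (g : P) i, r.symm (g • i) = g • r.symm i := fun g i => by
    rw [Equiv.symm_apply_eq, hr, Equiv.apply_symm_apply]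
  have := h.map (D := (completeGraphComplex P I).twoStep hX)
    (pull r.symm fun _ => LinearMap.id) (pull r.symm fun _ => LinearMap.id)
    (fun g f => pull_equivariant _ _ ρ _ _ hr' (fun g i b => rfl) g f)
    (fun g f => pull_equivariant _ _ ρ _ _ hr' (fun g i b => rfl) g f) (fun f => rfl) (fun x => ?_)
    (fun f hf => ?_)
  · convert this using 1
    refine MultilinearMap.ext fun (y : I → P × P →₀ ℤ) => ?_
    simp only [prodSmul_apply, pull_apply, LinearMap.id_apply]
    congr 1
    refine Fintype.prod_equiv r _ _ fun i => ?_
    rw [Equiv.symm_apply_apply]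
    rfl
  · refine MultilinearMap.ext fun (y : I → P →₀ ℤ) => ?_
    change (∏ i, (completeGraphComplex P I).ε (y (r.symm i))) • x =
      (∏ i, (completeGraphComplex P I).ε (y i)) • x
    congr 1
    exact Fintype.prod_equiv r.symm _ _ fun i => rfl
  · intro y T hT hy
    refine hf _ univ card_univ fun i _ => hy _ ?_
    rw [(card_eq_iff_eq_univ T).1 hT]
    exact mem_univ _

lemma prodSmul_sub_mem (hX : ProperlyProjective ρ) {Θ Θ' : I → (P × P →₀ ℤ) →ₗ[ℤ] ℤ}
    (h : ∀ i b, (completeGraphComplex P I).bd b = 0 → Θ i b = Θ' i b) (m : X) :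
    prodSmul Θ m - prodSmul Θ' m ∈ ((completeGraphComplex P I).twoStep hX).K₁ := by
  intro y T hT hy
  rw [_root_.sub_apply, prodSmul_apply, prodSmul_apply, sub_eq_zero]
  congr 1
  refine prod_congr rfl fun i _ => h i _ (LinearMap.mem_ker.1 (hy i ?_))
  rw [(card_eq_iff_eq_univ T).1 hT]
  exact mem_univ i

lemma mem_ker_of_winding_principal (hX : ProperlyProjective ρ) (U : CycleData P I N)
    (hU : U.cocycle.FixedPointFree) {m : X} (hm : norm ρ m = 0)
    (h : ∀ z, ((completeGraphComplex P I).twoStep hX).Connects (prodSmul U.winding m) z →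
      ∃ x, ∀ g, z g = ρ g x - x) : m ∈ Coinvariants.ker ρ := by
  have hcyc : U.cocycle.cycleComplex.IsCycleClass fun _ => Finsupp.lapply 0 := by
    intro g i b hb
    rw [eq_smul_fundamentalCycle hb]
    change (Finsupp.mapDomain _ _) 0 = _
    rw [Finsupp.mapDomain_smul, translate_fundamentalCycle]
    rfl
  obtain ⟨z, hz⟩ := hcyc.exists_connects hX hm
  obtain ⟨x, hx⟩ := h z (connects_winding hX U hz)
  exact SlotCocycle.mem_ker_of_principal hX _ hU hz x hx

/-- The conclusion obtained from a permutation of the slots commuting with the action. -/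
theorem mem_ker_of_reindex (hX : ProperlyProjective ρ) (U : CycleData P I N)
    (r : Equiv.Perm I) (hr : ∀ (g : P) i, r (g • i) = g • r i)
    (hU : ((U.reindex r hr).sub U).cocycle.FixedPointFree) {m : X} (hm : norm ρ m = 0) :
    m ∈ Coinvariants.ker ρ := by
  refine mem_ker_of_winding_principal hX _ hU hm fun z hz => ?_
  set V := (U.reindex r hr).sub U
  obtain ⟨z₁, hz₁⟩ := U.isCycleClass_winding.exists_connects hX hm
  have h₁ := (hz.sub ((connects_reindex hX U r hr hz₁).sub hz₁))
  rw [sub_self, sub_zero] at h₁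
  have hadd : ∀ i b, (completeGraphComplex P I).bd b = 0 →
      (U.reindex r hr).winding i b = (fun i => V.winding i + U.winding i) i b := fun i b hb => by
    refine mul_left_cancel₀ (a := (N : ℤ)) (by exact_mod_cast NeZero.ne N) ?_
    rw [LinearMap.add_apply, mul_add, mul_winding _ _ hb, mul_winding _ _ hb, mul_winding _ _ hb]
    simp only [totalLength, V, sub_len, reindex_len, Finsupp.linearCombination_apply,
      ← Finsupp.sum_add, ← smul_add, sub_add_cancel]
  have hmem := prodSmul_sub_mem hX hadd m
  obtain ⟨k, hk, hk'⟩ := (completeGraphComplex P I).prodSmul_add_mem hX V.isCycleClass_winding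
    U.isCycleClass_winding hm
  refine h₁.principal (k := -k - (prodSmul (U.reindex r hr).winding m -
    prodSmul (fun i => V.winding i + U.winding i) m)) ?_ (sub_mem (neg_mem hk) hmem)
  have e : ∀ v a u k s : MultilinearMap ℤ (fun _ : I => P × P →₀ ℤ) X,
      v - (a - u) - (-k - (a - s)) = -(s - v - u - k) := fun v a u k s => by abel
  rw [e]
  exact neg_mem hk'

end CycleData

/-- The conclusion obtained from a lift of a class to a multiple of the modulus. -/
theorem CycleData.mem_ker_of_lift (hX : ProperlyProjective ρ) {p : ℕ} [NeZero p]
    (V : CycleData P PUnit.{1} N)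
    (U : CycleData P PUnit.{1} (p * N))
    (hlen : V.len = U.len) (hV : V.cocycle.FixedPointFree) {m : X} (hm : norm ρ m = 0)
    (hpm : (p : ℤ) • m ∈ Coinvariants.ker ρ) : m ∈ Coinvariants.ker ρ := by
  refine mem_ker_of_winding_principal hX V hV hm fun z hz => ?_
  have h : prodSmul V.winding m - prodSmul U.winding ((p : ℤ) • m) ∈
      ((completeGraphComplex P PUnit.{1}).twoStep hX).K₁ := by
    rw [map_smul]
    convert prodSmul_sub_mem (Θ' := fun i => (p : ℤ) • U.winding i) hX (fun i b hb => ?_) m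
    · refine MultilinearMap.ext fun (y : PUnit → P × P →₀ ℤ) => ?_
      simp [mul_smul]
    · refine mul_left_cancel₀ (a := (N : ℤ)) (by exact_mod_cast NeZero.ne N) ?_
      have := mul_winding U i hb
      rw [mul_winding _ _ hb, LinearMap.smul_apply, smul_eq_mul, ← mul_assoc, mul_comm (N : ℤ)]
      push_cast at this
      rw [this, totalLength, totalLength, hlen]
  obtain ⟨k, hk, hk'⟩ := U.isCycleClass_winding.exists_ker_sub_mem hpm
  exact (hz.congr h).principal hk' hk

end CycleClasses

section Groups

lemma ProperlyProjective.exists_conjTrace_eq_index_smul {P X : Type*} [Group P] [Fintype P]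
    [AddCommGroup X] {ρ : Representation ℤ P X} (hX : ProperlyProjective ρ) {S : Subgroup P}
    (hS : S ≠ ⊤) : ∃ s : X →ₗ[ℤ] X, ∀ x, conjTrace ρ s x = (S.index : ℤ) • x := by
  classical
  obtain ⟨t, ht⟩ := hX.exists_family (P ⧸ S)
  have hstab : ∀ a : P ⧸ S, MulAction.stabilizer P a ≠ ⊤ := fun a htop => by
    refine hS (Subgroup.eq_top_iff' S |>.2 fun x => ?_)
    obtain ⟨g, rfl⟩ := QuotientGroup.mk_surjective a
    have h : (g * x * g⁻¹) • (g : P ⧸ S) = g :=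
      MulAction.mem_stabilizer_iff.1 (htop ▸ Subgroup.mem_top _)
    rw [MulAction.Quotient.smul_mk, smul_eq_mul, inv_mul_cancel_right, eq_comm,
      QuotientGroup.eq] at h
    simpa using h
  refine ⟨∑ a, t a, fun x => ?_⟩
  have h : ∑ a : P ⧸ S, x = ∑ a : P ⧸ S, ∑ g, ρ g (t (g⁻¹ • a) (ρ g⁻¹ x)) :=
    sum_congr rfl fun a _ => (ht a (hstab a) x).symm
  rw [sum_comm] at h
  rw [sum_const, card_univ, ← Nat.card_eq_fintype_card, ← Subgroup.index] at h
  rw [natCast_zsmul, h, conjTrace_apply]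
  refine sum_congr rfl fun g _ => ?_
  rw [← map_sum, LinearMap.sum_apply]
  congr 1
  exact (Fintype.sum_equiv (MulAction.toPerm g⁻¹) _ _ fun _ => rfl).symm

lemma ProperlyProjective.index_smul_mem_ker {P X : Type*} [Group P] [Fintype P] [AddCommGroup X]
    {ρ : Representation ℤ P X} (hX : ProperlyProjective ρ) {S : Subgroup P} (hS : S ≠ ⊤) {m : X}
    (hm : norm ρ m = 0) : (S.index : ℤ) • m ∈ Coinvariants.ker ρ := by
  obtain ⟨s, hs⟩ := hX.exists_conjTrace_eq_index_smul hS
  rw [← hs, conjTrace_apply]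
  exact sum_mem_ker ρ ρ s hm

lemma exists_hom_zmod_ne_zero {A : Type*} [CommGroup A] [Finite A] {x : A} (hx : x ≠ 1) :
    ∃ N : ℕ, N ≠ 0 ∧ ∃ u : A → ZMod N, (∀ a b, u (a * b) = u a + u b) ∧ u x ≠ 0 := by
  obtain ⟨ι, _, n, hn, ⟨e⟩⟩ := CommGroup.equiv_prod_multiplicative_zmod_of_finite A
  have : e x ≠ 1 := by simpa using hx
  obtain ⟨i, hi⟩ := Function.ne_iff.1 this
  refine ⟨n i, by have := hn i; omega, fun a => (e a i).toAdd, fun a b => by simp, ?_⟩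
  simpa using hi

lemma isElementaryAbelian_of_pow_eq_one {P : Type} [Group P] [Finite P] {p : ℕ} [Fact p.Prime]
    (hc : ∀ a b : P, a * b = b * a) (hp : ∀ a : P, a ^ p = 1) : IsElementaryAbelian P := by
  let _ : CommGroup P := { mul_comm := hc }
  have hp' : ∀ x : Additive P, p • x = 0 := fun x => congrArg Additive.ofMul (hp x.toMul)
  have : Module (ZMod p) (Additive P) := AddCommGroup.zmodModule hp'
  have e := (Module.finBasis (ZMod p) (Additive P)).equivFun.toAddEquiv
  exact ⟨p, _, Fact.out, ⟨AddEquiv.toMultiplicativeRight e⟩⟩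

variable {P X : Type*} [Group P] [Fintype P] [AddCommGroup X] {ρ : Representation ℤ P X} {p : ℕ}

lemma cast_val_sub {N : ℕ} [NeZero N] (a b : ZMod N) : (((a - b).val : ℤ) : ZMod N) = a - b := by
  simp

lemma mem_ker_of_comm [Fact p.Prime] (hP : IsPGroup p P) (hc : ∀ a b : P, a * b = b * a)
    {g : P} (hg : g ^ p ≠ 1) (hX : ProperlyProjective ρ) {m : X} (hm : norm ρ m = 0) :
    m ∈ Coinvariants.ker ρ := by
  have hp : p.Prime := Fact.out
  let _ : CommGroup P := { mul_comm := hc }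
  obtain ⟨N, hN, u, hu, hug⟩ := exists_hom_zmod_ne_zero hg
  let u' : P →* Multiplicative (ZMod N) :=
    MonoidHom.mk' (fun a => Multiplicative.ofAdd (u a)) fun a b => by rw [hu]; rfl
  have hpow : ∀ a (n : ℕ), u (a ^ n) = n * u a := fun a n => by
    have := congrArg Multiplicative.toAdd (map_pow u' a n)
    simpa [u'] using this
  have hpN : p ∣ N := by
    by_contra h
    obtain ⟨k, hk⟩ := hP g
    have h1 : ((p ^ k : ℕ) : ZMod N) * u g = 0 := by
      rw [← hpow, hk]
      simpa using hpow 1 0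
    have hcop : (p ^ k).Coprime N := Nat.Coprime.pow_left k ((Nat.Prime.coprime_iff_not_dvd hp).2 h)
    have h0 : u g = 0 := by
      rwa [((ZMod.isUnit_iff_coprime _ _).2 hcop).mul_right_eq_zero] at h1
    rw [hpow, h0, mul_zero] at hug
    exact hug rfl
  obtain ⟨k, rfl⟩ := hpN
  have : NeZero k := ⟨fun h => hN (by rw [h, mul_zero])⟩
  have : NeZero p := ⟨hp.ne_zero⟩
  let c : ZMod (p * k) →+* ZMod k := ZMod.castHom (dvd_mul_left k p) _
  let U : CycleData P PUnit.{1} (p * k) :=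
    { w g _ := u g
      Γ _ x := u x
      len _ x y := (u y - u x).val
      Γ_smul g i x := by rw [hu, add_comm]
      len_smul g i x y := by rw [hu, hu, add_sub_add_left_eq_sub]
      len_cast i x y := cast_val_sub _ _ }
  let V : CycleData P PUnit.{1} k :=
    { w g i := c (U.w g i)
      Γ i x := c (U.Γ i x)
      len := U.len
      Γ_smul g i x := by rw [U.Γ_smul, map_add]
      len_smul := U.len_smul
      len_cast i x y := by rw [← map_sub, ← U.len_cast, map_intCast] }
  obtain ⟨n, hn⟩ := IsPGroup.iff_card.1 hP
  have hn0 : n ≠ 0 := fun h => hg <| by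
    have : Subsingleton P := (Nat.card_eq_one_iff_unique.1 (by rw [hn, h, pow_zero])).1
    exact Subsingleton.elim _ _
  obtain ⟨n, rfl⟩ := Nat.exists_eq_succ_of_ne_zero hn0
  obtain ⟨S, hS⟩ := Sylow.exists_subgroup_card_pow_prime p (G := P) (n := n)
    (by rw [hn]; exact pow_dvd_pow p n.le_succ)
  have hidx : S.index = p := by
    have := S.card_mul_index
    rw [hS, hn, pow_succ] at this
    exact Nat.eq_of_mul_eq_mul_left (pow_pos hp.pos n) this
  have hST : S ≠ ⊤ := fun h => by
    rw [h, Subgroup.index_top] at hidx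
    exact hp.one_lt.ne hidx
  refine CycleData.mem_ker_of_lift hX V U rfl (fun d => ⟨g, ⟨⟩, ?_⟩) hm
    (hidx ▸ hX.index_smul_mem_ker hST hm)
  change d ⟨⟩ ≠ d ⟨⟩ + c (u g)
  intro h
  have h0 : c (u g) = 0 := by simpa using h
  have h1 : (((u g).val : ℕ) : ZMod k) = 0 := by
    rw [← h0, ← map_natCast c, ZMod.natCast_zmod_val]
  rw [ZMod.natCast_eq_zero_iff] at h1
  refine hug ?_
  rw [hpow, ← ZMod.natCast_zmod_val (u g), ← Nat.cast_mul, ZMod.natCast_eq_zero_iff]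
  exact Nat.mul_dvd_mul_left p h1

lemma exists_normal_comm_of_not_comm [Fact p.Prime] (hP : IsPGroup p P) {x y : P}
    (hxy : x * y ≠ y * x) :
    ∃ E : Subgroup P, E.Normal ∧ (∀ a ∈ E, ∀ b ∈ E, a * b = b * a) ∧
      ∃ e ∈ E, ∃ a, a⁻¹ * e * a ≠ e := by
  have hnt : Nontrivial (P ⧸ Subgroup.center P) := by
    refine ⟨(x : P ⧸ Subgroup.center P), 1, fun h => hxy ?_⟩
    rw [QuotientGroup.eq_one_iff, Subgroup.mem_center_iff] at h
    exact (h y).symm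
  have := IsPGroup.center_nontrivial (hP.to_quotient (Subgroup.center P))
  obtain ⟨c, hc⟩ := exists_ne (1 : Subgroup.center (P ⧸ Subgroup.center P))
  obtain ⟨g, hg⟩ := QuotientGroup.mk_surjective (c : P ⧸ Subgroup.center P)
  let Z := Subgroup.zpowers (g : P ⧸ Subgroup.center P)
  have hZ : Z ≤ Subgroup.center (P ⧸ Subgroup.center P) := by
    rw [Subgroup.zpowers_le, hg]; exact c.2
  have hZn : Z.Normal := ⟨fun z hz b => by
    rw [Subgroup.mem_center_iff.1 (hZ hz) b, mul_inv_cancel_right]; exact hz⟩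
  refine ⟨Z.comap (QuotientGroup.mk' _), hZn.comap _, ?_, g, Subgroup.mem_zpowers _, ?_⟩
  · let f : Z.comap (QuotientGroup.mk' (Subgroup.center P)) →* Z :=
      (QuotientGroup.mk' (Subgroup.center P)).subgroupComap Z
    have hf : f.ker ≤ Subgroup.center _ := fun a ha => by
      have h : ((a : P) : P ⧸ Subgroup.center P) = 1 := congrArg Subtype.val ha
      rw [QuotientGroup.eq_one_iff, Subgroup.mem_center_iff] at h
      exact Subgroup.mem_center_iff.2 fun b => Subtype.ext (h b)
    intro a ha b hb
    have := MonoidHom.isMulCommutative_of_isCyclic_of_ker_le_center f hf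
    exact congrArg Subtype.val (mul_comm' (⟨a, ha⟩ : Z.comap _) ⟨b, hb⟩)
  · by_contra! h
    refine hc (Subtype.ext ?_)
    rw [← hg]
    refine (QuotientGroup.eq_one_iff g).2 (Subgroup.mem_center_iff.2 fun a => ?_)
    have := h a
    rw [mul_assoc, inv_mul_eq_iff_eq_mul] at this
    exact this.symm

/-- The cycle data obtained from a character of a normal subgroup, with slots the cosets. -/
@[simps]
def cosetCycleData {N : ℕ} [NeZero N] (E : Subgroup P) [E.Normal] (u : P → ZMod N)
    (hu : ∀ a ∈ E, ∀ b ∈ E, u (a * b) = u a + u b) : CycleData P (P ⧸ E) N :=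
  let Γ : P ⧸ E → P → ZMod N := fun i x =>
    u (i.out⁻¹ * x * (QuotientGroup.mk (s := E) (i.out⁻¹ * x)).out⁻¹)
  let w : P → P ⧸ E → ZMod N := fun g i => u ((g • i).out⁻¹ * g * i.out)
  have hout : ∀ y : P, y * (QuotientGroup.mk (s := E) y).out⁻¹ ∈ E := fun y => by
    have := QuotientGroup.eq.1 (QuotientGroup.out_eq' (QuotientGroup.mk (s := E) y)).symm
    have := inv_mem (Subgroup.Normal.conj_mem ‹_› _ this y)
    simpa [mul_assoc] using this
  have hw : ∀ (g : P) (i : P ⧸ E), (g • i).out⁻¹ * g * i.out ∈ E := fun g i => by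
    rw [mul_assoc]
    refine QuotientGroup.eq.1 ?_
    rw [QuotientGroup.out_eq', ← smul_eq_mul, ← MulAction.Quotient.smul_mk, QuotientGroup.out_eq']
  have hΓ : ∀ g i x, Γ (g • i) (g * x) = Γ i x + w g i := fun g i x => by
    have h : (g • i).out⁻¹ * (g * x) = (g • i).out⁻¹ * g * i.out * (i.out⁻¹ * x) := by group
    have h' : QuotientGroup.mk (s := E) ((g • i).out⁻¹ * (g * x)) = (i.out⁻¹ * x : P) := by
      rw [h, QuotientGroup.mk_mul, (QuotientGroup.eq_one_iff _).2 (hw g i), one_mul]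
    simp only [Γ, w]
    rw [h', h, mul_assoc ((g • i).out⁻¹ * g * i.out), hu _ (hw g i) _ (hout _), add_comm]
  { w := w
    Γ := Γ
    len i x y := (Γ i y - Γ i x).val
    Γ_smul := hΓ
    len_smul g i x y := by rw [hΓ, hΓ, add_sub_add_right_eq_sub]
    len_cast i x y := cast_val_sub _ _ }

lemma mem_ker_of_not_comm [Fact p.Prime] (hP : IsPGroup p P) {x y : P} (hxy : x * y ≠ y * x)
    (hX : ProperlyProjective ρ) {m : X} (hm : norm ρ m = 0) : m ∈ Coinvariants.ker ρ := by
  classical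
  obtain ⟨E, hE, hcomm, e, he, a, hea⟩ := exists_normal_comm_of_not_comm hP hxy
  have hconj : ∀ b, b⁻¹ * e * b ∈ E := fun b => by simpa using hE.conj_mem e he b⁻¹
  let _ : CommGroup E := { mul_comm := fun a b => Subtype.ext (hcomm a a.2 b b.2) }
  obtain ⟨N, hN, u', hu', hne⟩ := exists_hom_zmod_ne_zero
    (x := (⟨a⁻¹ * e * a, hconj a⟩ / ⟨e, he⟩ : E)) (by
      rw [Ne, div_eq_one]; exact fun h => hea (congrArg Subtype.val h))
  have : NeZero N := ⟨hN⟩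
  let u : P → ZMod N := fun b => if h : b ∈ E then u' ⟨b, h⟩ else 0
  have hu : ∀ a ∈ E, ∀ b ∈ E, u (a * b) = u a + u b := fun a ha b hb => by
    simp only [u, dif_pos ha, dif_pos hb, dif_pos (mul_mem ha hb)]
    exact hu' ⟨a, ha⟩ ⟨b, hb⟩
  have hue : u (a⁻¹ * e * a) ≠ u e := fun h => hne <| by
    have := hu' (⟨a⁻¹ * e * a, hconj a⟩ / ⟨e, he⟩) ⟨e, he⟩
    rw [div_mul_cancel] at this
    simp only [u, dif_pos he, dif_pos (hconj a)] at h
    rw [h] at this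
    simpa using this
  let U := cosetCycleData E u hu
  have hsmul : ∀ i : P ⧸ E, e • i = i := fun i => by
    obtain ⟨b, rfl⟩ := QuotientGroup.mk_surjective i
    rw [MulAction.Quotient.smul_mk, eq_comm, QuotientGroup.eq, smul_eq_mul, ← mul_assoc]
    exact hconj b
  have hw : ∀ b : P, U.w e b = u (b⁻¹ * e * b) := fun b => by
    change u ((e • (b : P ⧸ E)).out⁻¹ * e * (b : P ⧸ E).out) = _
    rw [hsmul]
    have hc := QuotientGroup.eq.1 (QuotientGroup.out_eq' (QuotientGroup.mk (s := E) b)).symm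
    set c := b⁻¹ * (b : P ⧸ E).out with hc'
    have hb : (b : P ⧸ E).out = b * c := by rw [hc', mul_inv_cancel_left]
    rw [hb]
    congr 1
    rw [mul_inv_rev, mul_assoc, ← mul_assoc e, mul_assoc, inv_mul_eq_iff_eq_mul,
      hcomm c hc _ (hconj b)]
    group
  let r : Equiv.Perm (P ⧸ E) := Equiv.mulRight (a : P ⧸ E)
  have hr : ∀ (g : P) i, r (g • i) = g • r i := fun g i => by
    obtain ⟨b, rfl⟩ := QuotientGroup.mk_surjective i
    exact congrArg QuotientGroup.mk (mul_assoc g b a)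
  refine CycleData.mem_ker_of_reindex hX U r hr (fun d => ⟨e, ((1 : P) : P ⧸ E), ?_⟩) hm
  rw [hsmul]
  change _ ≠ _ + (U.w e (((1 : P) : P ⧸ E) * (a : P ⧸ E)) - U.w e ((1 : P) : P ⧸ E))
  rw [← QuotientGroup.mk_mul, one_mul, hw, hw]
  intro h
  refine hue ?_
  have := left_eq_add.1 h
  simpa using sub_eq_zero.1 this

/-- For finite `p`-groups which are not elementary abelian, weak projectivity on all proper
subgroups forces the vanishing of the Tate cohomology group `ker (norm) / I_P X`. -/
theorem mem_ker_of_isPGroup {P : Type} [Group P] [Fintype P] {ρ : Representation ℤ P X}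
    [Fact p.Prime] (hP : IsPGroup p P) (hne : ¬ IsElementaryAbelian P)
    (hX : ProperlyProjective ρ) {m : X} (hm : norm ρ m = 0) : m ∈ Coinvariants.ker ρ := by
  by_cases hc : ∀ a b : P, a * b = b * a
  · have : ∃ g : P, g ^ p ≠ 1 := by
      by_contra! h
      exact hne (isElementaryAbelian_of_pow_eq_one hc h)
    obtain ⟨g, hg⟩ := this
    exact mem_ker_of_comm hP hc hg hX hm
  · push Not at hc
    obtain ⟨x, y, hxy⟩ := hc
    exact mem_ker_of_not_comm hP hxy hX hm

end Groups

section Rings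

section

variable {P Λ : Type*} [Group P] [Ring Λ] [MulSemiringAction P Λ]

lemma properlyProjective_ofDistribMulAction
    (h : ∀ S : Subgroup P, S ≠ ⊤ → ∃ x : Λ, ∑ᶠ g : S, g • x = 1) [Finite P] :
    ProperlyProjective (ofDistribMulAction ℤ P Λ) := by
  intro S hS
  obtain ⟨x, hx⟩ := h S hS
  have := Fintype.ofFinite S
  refine ⟨LinearMap.mulLeft ℤ x, fun y => ?_⟩
  rw [finsum_eq_sum_of_fintype] at hx ⊢
  conv_rhs => rw [← one_mul y, ← hx, sum_mul]
  refine sum_congr rfl fun g _ => ?_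
  simp only [ofDistribMulAction_apply_apply, LinearMap.mulLeft_apply, smul_mul', smul_inv_smul]
  rfl

variable (P Λ) in
/-- The coinduced representation on functions `P → Λ`. -/
def funRep : Representation ℤ P (P → Λ) where
  toFun g :=
    { toFun f h := g • f (g⁻¹ * h)
      map_add' _ _ := by ext; simp
      map_smul' n f := by ext h; exact smul_comm g n _ }
  map_one' := by ext; simp
  map_mul' g h := by ext; simp [mul_smul, mul_assoc]

@[simp]
lemma funRep_apply (g : P) (f : P → Λ) (h : P) : funRep P Λ g f h = g • f (g⁻¹ * h) := rfl

variable (P Λ) in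
/-- The constant functions. -/
def constFun : Submodule ℤ (P → Λ) where
  carrier := {f | ∃ c, ∀ h, f h = c}
  add_mem' := by
    rintro f g ⟨c, hc⟩ ⟨d, hd⟩
    exact ⟨c + d, fun h => by simp [hc, hd]⟩
  zero_mem' := ⟨0, fun _ => rfl⟩
  smul_mem' := by
    rintro n f ⟨c, hc⟩
    exact ⟨n • c, fun h => by simp [hc]⟩

lemma constFun_le_comap (g : P) : constFun P Λ ≤ (constFun P Λ).comap (funRep P Λ g) := by
  rintro f ⟨c, hc⟩
  exact ⟨g • c, fun h => by simp [hc]⟩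

variable (P Λ) in
/-- Functions modulo constants. -/
def funModConst : Representation ℤ P ((P → Λ) ⧸ constFun P Λ) :=
  (funRep P Λ).quotient _ constFun_le_comap

lemma funModConst_mk (g : P) (f : P → Λ) :
    funModConst P Λ g (Submodule.Quotient.mk f) = Submodule.Quotient.mk (funRep P Λ g f) := rfl

lemma properlyProjective_funModConst
    (h : ∀ S : Subgroup P, S ≠ ⊤ → ∃ x : Λ, ∑ᶠ g : S, g • x = 1) [Finite P] :
    ProperlyProjective (funModConst P Λ) := by
  intro S hS
  obtain ⟨x, hx⟩ := h S hS
  have := Fintype.ofFinite S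
  rw [finsum_eq_sum_of_fintype] at hx
  let s : (P → Λ) →ₗ[ℤ] (P → Λ) := LinearMap.mulLeft ℤ fun _ => x
  refine ⟨(constFun P Λ).mapQ (constFun P Λ) s ?_, fun y => ?_⟩
  · rintro f ⟨c, hc⟩
    exact ⟨x * c, fun h => by simp [s, hc]⟩
  · obtain ⟨f, rfl⟩ := Submodule.Quotient.mk_surjective _ y
    rw [finsum_eq_sum_of_fintype]
    simp only [funModConst_mk, Submodule.mapQ_apply]
    rw [← Submodule.mkQ_apply]
    simp only [← Submodule.mkQ_apply]
    rw [← map_sum]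
    congr 1
    ext h
    conv_rhs => rw [← one_mul (f h), ← hx, sum_mul]
    rw [Finset.sum_apply]
    refine sum_congr rfl fun g _ => ?_
    simp only [s, funRep_apply, LinearMap.mulLeft_apply, Pi.mul_apply, smul_mul', inv_inv,
      mul_inv_cancel_left, smul_inv_smul]
    rfl

/-- Vanishing of the Tate cohomology of functions modulo constants gives an element of
trace one. -/
lemma one_mem_range_norm [Fintype P] (h : ∀ q, norm (funModConst P Λ) q = 0 →
    q ∈ Coinvariants.ker (funModConst P Λ)) :
    (1 : Λ) ∈ LinearMap.range (norm (ofDistribMulAction ℤ P Λ)) := by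
  classical
  set R := LinearMap.range (norm (ofDistribMulAction ℤ P Λ))
  let T : (P → Λ) →ₗ[ℤ] Λ :=
    ∑ g, ofDistribMulAction ℤ P Λ g⁻¹ ∘ₗ LinearMap.proj g
  have hT : ∀ f, T f = ∑ g, g⁻¹ • f g := fun f => by simp [T]
  have hTc : constFun P Λ ≤ R.comap T := by
    rintro f ⟨c, hc⟩
    refine ⟨c, ?_⟩
    rw [hT, norm_apply]
    simp only [hc]
    exact Fintype.sum_equiv (Equiv.inv P) _ _ fun g => by simp
  let T' := (constFun P Λ).mapQ R T hTc
  have hker : ∀ q ∈ Coinvariants.ker (funModConst P Λ), T' q = 0 := fun q hq => by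
    induction hq using Submodule.span_induction with
    | mem x h =>
      obtain ⟨⟨g, y⟩, rfl⟩ := h
      obtain ⟨f, rfl⟩ := Submodule.Quotient.mk_surjective _ y
      rw [map_sub, funModConst_mk]
      simp only [T', Submodule.mapQ_apply, hT]
      rw [sub_eq_zero]
      congr 1
      refine Fintype.sum_equiv (Equiv.mulLeft g⁻¹) _ _ fun h => ?_
      simp [mul_smul]
    | zero => exact map_zero _
    | add x y _ _ hx hy => rw [map_add, hx, hy, add_zero]
    | smul a x _ hx => rw [map_smul, hx, smul_zero]
  have hq := hker (Submodule.Quotient.mk (Pi.single 1 1)) (h _ ?_)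
  · simp only [T', Submodule.mapQ_apply, hT] at hq
    rw [Submodule.Quotient.mk_eq_zero, sum_eq_single 1 (fun g _ hg => by simp [hg]) (by simp)] at hq
    simpa using hq
  · rw [norm_apply]
    simp only [funModConst_mk]
    simp only [← Submodule.mkQ_apply]
    rw [← map_sum, Submodule.mkQ_apply, Submodule.Quotient.mk_eq_zero]
    refine ⟨1, fun h => ?_⟩
    rw [Finset.sum_apply, sum_eq_single h (fun g _ hg => ?_) (by simp)]
    · simp
    · rw [funRep_apply, Pi.single_eq_of_ne, smul_zero]
      exact fun e => hg (inv_mul_eq_one.1 e)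

end

variable {Λ : Type*} [Ring Λ]

lemma exists_trace_eq_one_of_proper {P : Type} [Group P] [Finite P] [MulSemiringAction P Λ]
    (hne : ¬ IsElementaryAbelian P)
    (h : ∀ S : Subgroup P, S ≠ ⊤ → ∃ x : Λ, ∑ᶠ g : S, g • x = 1) :
    ∃ x : Λ, ∑ᶠ g : P, g • x = 1 := by
  have := Fintype.ofFinite P
  suffices hone : (1 : Λ) ∈ LinearMap.range (norm (ofDistribMulAction ℤ P Λ)) by
    obtain ⟨x, hx⟩ := hone
    refine ⟨x, ?_⟩
    rw [finsum_eq_sum_of_fintype, ← hx, norm_apply]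
    rfl
  by_cases hp : ∃ p : ℕ, p.Prime ∧ IsPGroup p P
  · obtain ⟨p, hp, hP⟩ := hp
    have : Fact p.Prime := ⟨hp⟩
    exact one_mem_range_norm fun q hq =>
      mem_ker_of_isPGroup hP hne (properlyProjective_funModConst h) hq
  · push Not at hp
    let J : Ideal ℤ := Submodule.comap (LinearMap.toSpanSingleton ℤ Λ 1)
      (LinearMap.range (norm (ofDistribMulAction ℤ P Λ)))
    have hJ : ∀ S : Subgroup P, S ≠ ⊤ → (S.index : ℤ) ∈ J := fun S hS => by
      obtain ⟨s, hs⟩ := (properlyProjective_ofDistribMulAction h).exists_conjTrace_eq_index_smul hS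
      refine ⟨s 1, ?_⟩
      rw [norm_of_conjTrace_of_invariant _ _ (by simp), hs]
      rfl
    suffices h1 : (1 : ℤ) ∈ J by simpa [J] using h1
    obtain ⟨a, ha⟩ := IsPrincipalIdealRing.principal J
    have hdvd : ∀ S : Subgroup P, S ≠ ⊤ → a ∣ S.index := fun S hS => by
      have := hJ S hS
      rwa [ha, Ideal.submodule_span_eq, Ideal.mem_span_singleton] at this
    suffices ha1 : a.natAbs = 1 by
      rw [ha, Ideal.submodule_span_eq, Ideal.mem_span_singleton]
      exact (Int.isUnit_iff_natAbs_eq.2 ha1).dvd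
    by_contra hne1
    obtain ⟨p, hpp, hpa⟩ := Nat.exists_prime_and_dvd hne1
    have : Fact p.Prime := ⟨hpp⟩
    let S : Sylow p P := default
    refine S.not_dvd_index (hpa.trans ?_)
    refine Int.natCast_dvd_natCast.1 (Int.natAbs_dvd.2 (hdvd S fun hS => hp p hpp ?_))
    have hS' : IsPGroup p (S : Subgroup P) := S.isPGroup'
    rw [hS] at hS'
    exact hS'.of_equiv Subgroup.topEquiv

/-- An element of trace one exists as soon as it exists for all elementary abelian subgroups. -/
theorem exists_trace_eq_one {P : Type} [Group P] [Finite P] [MulSemiringAction P Λ]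
    (h : ∀ S : Subgroup P, IsElementaryAbelian S → ∃ x : Λ, ∑ᶠ g : S, g • x = 1)
    (S : Subgroup P) : ∃ x : Λ, ∑ᶠ g : S, g • x = 1 := by
  induction hn : Nat.card S using Nat.strong_induction_on generalizing S with
  | _ n ih =>
    by_cases hS : IsElementaryAbelian S
    · exact h S hS
    refine exists_trace_eq_one_of_proper hS fun T hT => ?_
    have hlt : Nat.card (T.map S.subtype) < n := by
      rw [Subgroup.card_map_of_injective S.subtype_injective, ← hn]
      exact lt_of_le_of_ne (Subgroup.card_le_card_group T)
        fun he => hT (Subgroup.eq_top_of_card_eq T he)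
    obtain ⟨x, hx⟩ := ih _ hlt _ rfl
    refine ⟨x, ?_⟩
    rw [← hx]
    exact finsum_eq_of_bijective _
      (T.equivMapOfInjective S.subtype S.subtype_injective).bijective fun g => rfl

end Rings

end RelTrace

namespace RelTrace

open MonoidAlgebra Finset

section FreeCover

variable {R A M : Type*} [Ring R] [Ring A] [AddCommGroup M] [Module A M]

/-- The canonical map onto an `A`-module from the free `R`-module on its elements, for a ring
homomorphism `φ : R →+* A`. -/
def freeCover (φ : R →+* A) : (M →₀ R) →+ M :=
  Finsupp.liftAddHom fun x =>
    ((Module.toAddMonoidEnd A M).toAddMonoidHom.comp φ.toAddMonoidHom).flip x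

lemma freeCover_single (φ : R →+* A) (x : M) (a : R) :
    freeCover φ (Finsupp.single x a) = φ a • x :=
  Finsupp.liftAddHom_apply_single _ _ _

lemma freeCover_smul (φ : R →+* A) (a : R) (f : M →₀ R) :
    freeCover φ (a • f) = φ a • freeCover φ f := by
  induction f using Finsupp.induction_linear with
  | zero => simp
  | add f g hf hg => rw [smul_add, map_add, map_add, hf, hg, smul_add]
  | single x b =>
    rw [Finsupp.smul_single, freeCover_single, freeCover_single, smul_eq_mul, map_mul, mul_smul]

end FreeCover

section GroupRing

variable {k G M : Type} [Ring k] [Group G] [AddCommGroup M] [Module (MonoidAlgebra k G) M]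

@[simp]
lemma subgroupRingHom_single (H : Subgroup G) (h : H) (r : k) :
    subgroupRingHom k H (single h r) = single (h : G) r :=
  mapDomain_single

lemma exists_section {M : ModuleCat.{0} (MonoidAlgebra k G)} {E : Subgroup G}
    (h : Projective (resMod k E M)) : ∃ σ : M →+ (M →₀ MonoidAlgebra k E),
      (∀ a m, σ (subgroupRingHom k E a • m) = a • σ m) ∧
      ∀ m, freeCover (subgroupRingHom k E) (σ m) = m := by
  have : Module.Projective (MonoidAlgebra k E) (resMod k E M) :=
    (IsProjective.iff_projective _).2 h
  obtain ⟨σ, hσ⟩ := this.out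
  refine ⟨σ.toAddMonoidHom, fun a m => σ.map_smul a m, fun m => ?_⟩
  refine Eq.trans ?_ (hσ m)
  rw [Finsupp.linearCombination_apply]
  rfl

section Restriction

variable {H : Subgroup G}

open Classical in
variable (k H) in
/-- The part of an element of `k[E]` that is supported in `H`. -/
def supportedPart (E : Subgroup G) : MonoidAlgebra k E →+ MonoidAlgebra k E :=
  coeffAddEquiv.symm.toAddMonoidHom.comp
    ((Finsupp.filterAddHom fun e : E => (e : G) ∈ H).comp coeffAddEquiv.toAddMonoidHom)

open Classical in
lemma coeff_supportedPart {E : Subgroup G} (a : MonoidAlgebra k E) (e : E) :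
    (supportedPart k H E a).coeff e = if (e : G) ∈ H then a.coeff e else 0 :=
  Finsupp.filter_apply _ _ _

lemma supportedPart_single_mul {E : Subgroup G} {h : E} (hh : (h : G) ∈ H) (r : k)
    (a : MonoidAlgebra k E) :
    supportedPart k H E (single h r * a) = single h r * supportedPart k H E a := by
  classical
  ext e
  have : (h : G)⁻¹ * e ∈ H ↔ (e : G) ∈ H := H.mul_mem_cancel_left (inv_mem hh)
  simp [coeff_supportedPart, this]

lemma sum_supportedPart [H.Normal] {E : Subgroup G} {S : Subgroup (G ⧸ H)} [Fintype S]
    (hE : ∀ e : E, ((e : G) : G ⧸ H) ∈ S) (c : S → E) (hc : ∀ q, ((c q : G) : G ⧸ H) = q)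
    (a : MonoidAlgebra k E) :
    ∑ q, single (c q) (1 : k) * supportedPart k H E (single (c q)⁻¹ (1 : k) * a) = a := by
  classical
  ext e
  rw [coeff_sum, Finsupp.finsetSum_apply]
  have key (q : S) : (single (c q) (1 : k) *
      supportedPart k H E (single (c q)⁻¹ (1 : k) * a)).coeff e =
      if q = ⟨_, hE e⟩ then a.coeff e else 0 := by
    have : (c q : G)⁻¹ * e ∈ H ↔ q = ⟨_, hE e⟩ := by
      rw [← QuotientGroup.eq, hc, Subtype.ext_iff]
    simp [coeff_supportedPart, this]
  simp [key]

end Restriction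

variable (k M) in
/-- The ring of `k[H]`-linear endomorphisms of a `k[G]`-module. -/
def relEnd (H : Subgroup G) : Subring (AddMonoid.End M) where
  carrier := {s | ∀ h ∈ H, ∀ (r : k) m, s (single h r • m) = single h r • s m}
  mul_mem' ha hb h hh r m := (congrArg _ (hb h hh r m)).trans (ha h hh r _)
  one_mem' _ _ _ _ := rfl
  add_mem' ha hb h hh r m :=
    (congrArg₂ (· + ·) (ha h hh r m) (hb h hh r m)).trans (smul_add _ _ _).symm
  zero_mem' _ _ _ _ := (smul_zero _).symm
  neg_mem' ha h hh r m :=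
    (congrArg Neg.neg (ha h hh r m)).trans (smul_neg _ _).symm

lemma relEnd_ext {H : Subgroup G} {s t : relEnd k M H} (h : ∀ m, s.1 m = t.1 m) : s = t :=
  Subtype.ext (AddMonoidHom.ext h)

lemma single_smul_single_smul (g h : G) (r t : k) (m : M) :
    single g r • single h t • m = single (g * h) (r * t) • m := by
  rw [smul_smul, single_mul_single]

lemma single_one_smul (m : M) : single (1 : G) (1 : k) • m = m := one_smul (MonoidAlgebra k G) m

variable (H : Subgroup G) [H.Normal]

/-- Conjugation by a group element on the `k[H]`-linear endomorphisms. -/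
def conjEnd (g : G) : relEnd k M H →+* relEnd k M H where
  toFun s := ⟨Module.toAddMonoidEnd (MonoidAlgebra k G) M (single g 1) * s.1 *
      Module.toAddMonoidEnd (MonoidAlgebra k G) M (single g⁻¹ 1), fun h hh r m => by
    have := s.2 (g⁻¹ * h * g) (by simpa using ‹H.Normal›.conj_mem h hh g⁻¹) r
      (single g⁻¹ (1 : k) • m)
    change single g (1 : k) • s.1 (single g⁻¹ (1 : k) • single h r • m) =
      single h r • single g (1 : k) • s.1 (single g⁻¹ (1 : k) • m)
    simp only [single_smul_single_smul, one_mul, mul_one, mul_inv_cancel_right] at this ⊢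
    rw [this, single_smul_single_smul]
    simp [mul_assoc]⟩
  map_one' := relEnd_ext fun m => by
    change single g (1 : k) • single g⁻¹ (1 : k) • m = m
    simp [single_smul_single_smul, single_one_smul]
  map_mul' s t := relEnd_ext fun m => by
    change single g (1 : k) • s.1 (t.1 (single g⁻¹ (1 : k) • m)) = single g (1 : k) •
      s.1 (single g⁻¹ (1 : k) • single g (1 : k) • t.1 (single g⁻¹ (1 : k) • m))
    simp [single_smul_single_smul, single_one_smul]
  map_zero' := relEnd_ext fun m => smul_zero _
  map_add' s t := relEnd_ext fun m => smul_add _ _ _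

lemma conjEnd_apply (g : G) (s : relEnd k M H) (m : M) :
    (conjEnd H g s).1 m = single g (1 : k) • s.1 (single g⁻¹ (1 : k) • m) := rfl

lemma conjEnd_mul (g h : G) (s : relEnd k M H) :
    conjEnd H (g * h) s = conjEnd H g (conjEnd H h s) := relEnd_ext fun m => by
  simp [conjEnd_apply, single_smul_single_smul]

lemma conjEnd_of_mem {g : G} (hg : g ∈ H) (s : relEnd k M H) :
    conjEnd H g s = s := relEnd_ext fun m => by
  rw [conjEnd_apply, s.2 _ (inv_mem hg), single_smul_single_smul]
  simp [single_one_smul]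

variable (k M) in
/-- The conjugation action of the group on the `k[H]`-linear endomorphisms. -/
def conjAut : G →* RingAut (relEnd k M H) where
  toFun g := RingEquiv.ofRingHom (conjEnd H g) (conjEnd H g⁻¹)
    (RingHom.ext fun s => by simp [← conjEnd_mul, conjEnd_of_mem H H.one_mem])
    (RingHom.ext fun s => by simp [← conjEnd_mul, conjEnd_of_mem H H.one_mem])
  map_one' := RingEquiv.ext fun s => conjEnd_of_mem H H.one_mem s
  map_mul' g h := RingEquiv.ext fun s => conjEnd_mul H g h s

instance quotientAction : MulSemiringAction (G ⧸ H) (relEnd k M H) :=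
  MulSemiringAction.compHom _ <| QuotientGroup.lift H (conjAut k M H) fun _ hg =>
    RingEquiv.ext fun s => conjEnd_of_mem H hg s

lemma sum_smul_apply {ι : Type*} [Fintype ι] (c : ι → G) (s : relEnd k M H) (m : M) :
    (∑ i, (c i : G ⧸ H) • s).1 m =
      ∑ i, single (c i) (1 : k) • s.1 (single (c i)⁻¹ (1 : k) • m) := 
  map_sum ((AddMonoidHom.eval m : (M →+ M) →+ M).comp (relEnd k M H).subtype.toAddMonoidHom) _ _

end GroupRing

section Transfer

variable {k G M : Type} [Ring k] [Group G] [AddCommGroup M] [Module (MonoidAlgebra k G) M]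
  {H : Subgroup G} [H.Normal]

/-- A `k[E]`-linear section of the free cover gives a `k[H]`-linear endomorphism whose trace
from `H` to `E` is the identity. -/
lemma exists_trace_eq_one_of_section [H.FiniteIndex] {S : Subgroup (G ⧸ H)} {E : Subgroup G}
    (hE : ∀ g : G, g ∈ E ↔ (g : G ⧸ H) ∈ S)
    (σ : M →+ (M →₀ MonoidAlgebra k E))
    (hσ : ∀ a m, σ (subgroupRingHom k E a • m) = a • σ m)
    (hσ' : ∀ m, freeCover (subgroupRingHom k E) (σ m) = m) :
    ∃ s : relEnd k M H, ∑ᶠ q : S, q • s = 1 := by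
  have := Fintype.ofFinite S
  have hHE : H ≤ E := fun h hh => by
    rw [hE, (QuotientGroup.eq_one_iff h).2 hh]
    exact S.one_mem
  let pr : (M →₀ MonoidAlgebra k E) →+ (M →₀ MonoidAlgebra k E) :=
    Finsupp.mapRange.addMonoidHom (supportedPart k H E)
  have hpr (h : E) (hh : (h : G) ∈ H) (r : k) f : pr (single h r • f) = single h r • pr f :=
    Finsupp.ext fun x => supportedPart_single_mul hh r (f x)
  have hσG (e : E) (r : k) m : σ (single (e : G) r • m) = single e r • σ m := by
    rw [← hσ, subgroupRingHom_single]
  let s : relEnd k M H := ⟨(freeCover (subgroupRingHom k E)).comp (pr.comp σ), fun h hh r m => by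
    change freeCover _ (pr (σ _)) = single h r • freeCover _ (pr (σ m))
    rw [hσG ⟨h, hHE hh⟩, hpr ⟨h, hHE hh⟩ hh, freeCover_smul, subgroupRingHom_single]⟩
  have hs (m : M) : s.1 m = freeCover (subgroupRingHom k E) (pr (σ m)) := rfl
  let c : S → E := fun q => ⟨(q : G ⧸ H).out, by simp [hE]⟩
  have hc (q : S) : ((c q : G) : G ⧸ H) = q := QuotientGroup.out_eq' _
  refine ⟨s, ?_⟩
  rw [finsum_eq_sum_of_fintype]
  refine relEnd_ext fun m => ?_
  have hsum : ∑ q : S, q • s = ∑ q : S, ((c q : G) : G ⧸ H) • s :=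
    sum_congr rfl fun q _ => by rw [hc]; rfl
  rw [hsum, sum_smul_apply]
  refine Eq.trans ?_ (hσ' m)
  have key : σ m = ∑ q, single (c q) (1 : k) • pr (single (c q)⁻¹ (1 : k) • σ m) := by
    ext1 x
    rw [Finsupp.finsetSum_apply]
    exact (sum_supportedPart (fun e => (hE e).1 e.2) c hc (σ m x)).symm
  rw [key, map_sum]
  refine sum_congr rfl fun q _ => ?_
  rw [hs, freeCover_smul, subgroupRingHom_single, ← hσG]
  rfl

/-- A `k[H]`-linear section of the free cover and a `k[H]`-linear endomorphism whose trace to `G`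
is the identity give a `k[G]`-linear section. -/
lemma projective_of_trace_eq_one [H.FiniteIndex] (σ : M →+ (M →₀ MonoidAlgebra k H))
    (hσ : ∀ a m, σ (subgroupRingHom k H a • m) = a • σ m)
    (hσ' : ∀ m, freeCover (subgroupRingHom k H) (σ m) = m)
    (s : relEnd k M H) (hs : ∑ᶠ q : G ⧸ H, q • s = 1) :
    Module.Projective (MonoidAlgebra k G) M := by
  have := Fintype.ofFinite (G ⧸ H)
  let τ : M →+ (M →₀ MonoidAlgebra k G) :=
    (Finsupp.mapRange.addMonoidHom (subgroupRingHom k H).toAddMonoidHom).comp σ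
  have hτ (h : G) (hh : h ∈ H) (r : k) m : τ (single h r • m) = single h r • τ m := by
    have := hσ (single ⟨h, hh⟩ r) m
    rw [subgroupRingHom_single] at this
    ext1 x
    change subgroupRingHom k H (σ _ x) = single h r * subgroupRingHom k H (σ m x)
    rw [this, Finsupp.smul_apply, smul_eq_mul, map_mul, subgroupRingHom_single]
  have hτ' (m : M) : Finsupp.linearCombination (MonoidAlgebra k G) id (τ m) = m := by
    refine Eq.trans ?_ (hσ' m)
    rw [Finsupp.linearCombination_apply]
    exact Finsupp.sum_mapRange_index (hf := map_zero _) fun x => zero_smul _ _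
  let f (g : G) (m : M) : M →₀ MonoidAlgebra k G :=
    single g (1 : k) • τ (s.1 (single g⁻¹ (1 : k) • m))
  have hf (g h : G) (hh : h ∈ H) m : f (g * h) m = f g m := by
    have h1 : single (g * h)⁻¹ (1 : k) • m = single h⁻¹ (1 : k) • single g⁻¹ (1 : k) • m := by
      simp [single_smul_single_smul]
    simp only [f]
    rw [h1, s.2 _ (inv_mem hh), hτ _ (inv_mem hh), single_smul_single_smul]
    simp
  have hout (g : G) m : f (g : G ⧸ H).out m = f g m := by
    obtain ⟨h, hh⟩ := QuotientGroup.mk_out_eq_mul H g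
    rw [hh, hf _ _ h.2]
  have hfs (g g' : G) (r : k) m : f g' (single g r • m) = single g r • f (g⁻¹ * g') m := by
    have h1 : single g'⁻¹ (1 : k) • single g r • m =
        single (1 : G) r • single (g⁻¹ * g')⁻¹ (1 : k) • m := by
      simp [single_smul_single_smul]
    simp only [f]
    rw [h1, s.2 _ H.one_mem, hτ _ H.one_mem, single_smul_single_smul, single_smul_single_smul]
    simp
  let F (m : M) : M →₀ MonoidAlgebra k G := ∑ q : G ⧸ H, f q.out m
  have hFs (g : G) (r : k) m : F (single g r • m) = single g r • F m := by
    simp only [F, smul_sum, hfs]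
    refine Fintype.sum_equiv (MulAction.toPerm g⁻¹) _ _ fun q => ?_
    induction q using QuotientGroup.induction_on with
    | H x =>
      rw [← hfs, hout, hfs]
      exact congrArg _ (hout _ m).symm
  have hFa (m m' : M) : F (m + m') = F m + F m' := by
    simp only [F, f, smul_add, map_add, sum_add_distrib]
  refine ⟨⟨{ toFun := F, map_add' := hFa, map_smul' := fun a m => ?_ }, fun m => ?_⟩⟩
  · induction a using MonoidAlgebra.induction_linear with
    | zero => simp [F, f]
    | add a b ha hb =>
      simp only [RingHom.id_apply] at ha hb ⊢
      rw [add_smul, hFa, ha, hb, add_smul]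
    | single g r => exact hFs g r m
  · change Finsupp.linearCombination (MonoidAlgebra k G) id (F m) = m
    have hs1 : (∑ q : G ⧸ H, ((q.out : G) : G ⧸ H) • s).1 m = m := by
      simp only [QuotientGroup.out_eq']
      rw [← finsum_eq_sum_of_fintype, hs]
      rfl
    rw [sum_smul_apply] at hs1
    simp only [F, f, map_sum, map_smul, hτ']
    exact hs1

lemma isElementaryAbelian_quotient_of_comap {S : Subgroup (G ⧸ H)} (hS : IsElementaryAbelian S) :
    IsElementaryAbelian
      (S.comap (QuotientGroup.mk' H) ⧸ H.subgroupOf (S.comap (QuotientGroup.mk' H))) := by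
  obtain ⟨p, r, hp, ⟨e⟩⟩ := hS
  let φ := (QuotientGroup.mk' H).subgroupComap S
  have hφ : Function.Surjective φ :=
    MonoidHom.subgroupComap_surjective_of_surjective _ _ (QuotientGroup.mk'_surjective H)
  have hker : φ.ker = H.subgroupOf (S.comap (QuotientGroup.mk' H)) := by
    ext x
    rw [MonoidHom.mem_ker, Subgroup.mem_subgroupOf, Subtype.ext_iff]
    exact QuotientGroup.eq_one_iff _
  exact ⟨p, r, hp, ⟨(QuotientGroup.quotientMulEquivOfEq hker.symm).trans
    ((QuotientGroup.quotientKerEquivOfSurjective φ hφ).trans e)⟩⟩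

lemma isElementaryAbelian_of_subsingleton (Q : Type) [Group Q] [Subsingleton Q] :
    IsElementaryAbelian Q :=
  have : Unique Q := { default := 1, uniq := fun _ => Subsingleton.elim _ _ }
  ⟨2, 0, Nat.prime_two, ⟨MulEquiv.ofUnique⟩⟩

end Transfer

end RelTrace

/-- **Aljadeff–Ginosar** (group ring case): if `H ⊴ G` has finite index and `M` is
projective over `kE` for every subgroup `H ≤ E ≤ G` with `E/H` elementary abelian,
then `M` is projective over `kG`. -/
theorem projective_of_elementary_abelian_quotients
    (k : Type) [Ring k] (G : Type) [Group G]
    (H : Subgroup G) [H.Normal] [H.FiniteIndex]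
    (M : ModuleCat.{0} (MonoidAlgebra k G))
    (hyp : ∀ E : Subgroup G, H ≤ E → IsElementaryAbelian (E ⧸ H.subgroupOf E) →
      CategoryTheory.Projective (resMod k E M)) :
    CategoryTheory.Projective M := by
  obtain ⟨σ, hσ, hσ'⟩ := RelTrace.exists_section <| hyp H le_rfl <| by
    have : Subsingleton (H ⧸ H.subgroupOf H) := by
      rw [Subgroup.subgroupOf_self]
      exact QuotientGroup.subsingleton_quotient_top
    exact RelTrace.isElementaryAbelian_of_subsingleton _
  obtain ⟨s, hs⟩ := RelTrace.exists_trace_eq_one (Λ := RelTrace.relEnd k M H) (fun S hS => by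
    obtain ⟨τ, hτ, hτ'⟩ := RelTrace.exists_section <| hyp (S.comap (QuotientGroup.mk' H))
      (fun h hh => by simp [(QuotientGroup.eq_one_iff h).2 hh])
      (RelTrace.isElementaryAbelian_quotient_of_comap hS)
    exact RelTrace.exists_trace_eq_one_of_section (fun _ => Iff.rfl) τ hτ hτ') ⊤
  refine (IsProjective.iff_projective (R := MonoidAlgebra k G) M).1
    (RelTrace.projective_of_trace_eq_one σ hσ hσ' s ?_)
  rw [← hs]
  exact (finsum_eq_of_bijective _ Subgroup.topEquiv.bijective fun g => rfl).symm
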